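/- For all integers k and r with k ≥ 4r ≥ 12 there exists an integer n'_{k,r} ≥ k such that for every n ≥ n'_{k,r}, every connected r-uniform hypergraph on n vertices containing no Berge-path of length k has at most C(k − ⌊(k−1)/2⌋, r) + (n − k + ⌊(k−1)/2⌋)·C(⌊(k−1)/2⌋, r−1) hyperedges. -/

import Mathlib

open scoped Classical

/-- A Berge-path of length `t` in the hypergraph `H` (a family of hyperedges):
an alternating sequence of `t+1` distinct vertices and `t` distinct hyperedges
`v₁, e₁, …, e_t, v_{t+1}` with `vᵢ, vᵢ₊₁ ∈ eᵢ`. -/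
structure BergePath {V : Type*} (H : Finset (Finset V)) (t : ℕ) where
  verts : Fin (t + 1) → V
  edges : Fin t → Finset V
  verts_inj : Function.Injective verts
  edges_inj : Function.Injective edges
  edges_mem : ∀ i, edges i ∈ H
  fst_mem : ∀ i : Fin t, verts i.castSucc ∈ edges i
  snd_mem : ∀ i : Fin t, verts i.succ ∈ edges i

/-- A Berge-cycle of length `t` in the hypergraph `H`: `t` distinct vertices and
`t` distinct hyperedges with `vᵢ, vᵢ₊₁ ∈ eᵢ`, indices mod `t`. -/
structure BergeCycle {V : Type*} (H : Finset (Finset V)) (t : ℕ) where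
  verts : Fin t → V
  edges : Fin t → Finset V
  verts_inj : Function.Injective verts
  edges_inj : Function.Injective edges
  edges_mem : ∀ i, edges i ∈ H
  fst_mem : ∀ i, verts i ∈ edges i
  snd_mem : ∀ i : Fin t, verts ⟨(i.val + 1) % t, Nat.mod_lt _ i.pos⟩ ∈ edges i

/-- `u` and `v` are joined by a Berge-path of `H`. -/
def BergeReachable {V : Type*} (H : Finset (Finset V)) (u v : V) : Prop :=
  ∃ t, ∃ P : BergePath H t, P.verts 0 = u ∧ P.verts (Fin.last t) = v

/-- A hypergraph on the vertex type `V` is connected if any two vertices are joined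
by a Berge-path. -/
def HConnected {V : Type*} (H : Finset (Finset V)) : Prop :=
  ∀ u v : V, u ≠ v → BergeReachable H u v

/-- The degree of a vertex: the number of hyperedges containing it. -/
noncomputable def hdeg {V : Type*} (H : Finset (Finset V)) (v : V) : ℕ :=
  (H.filter (fun e => v ∈ e)).card

/-- The vertex neighborhood of `v` in `H`. -/
noncomputable def nbhd {V : Type*} [Fintype V] (H : Finset (Finset V)) (v : V) : Finset V :=
  Finset.univ.filter (fun u => u ≠ v ∧ ∃ e ∈ H, v ∈ e ∧ u ∈ e)

/-- The sub-hypergraph induced by a set `S` of vertices: all hyperedges lying inside `S`. -/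
noncomputable def restrictTo {V : Type*} (H : Finset (Finset V)) (S : Finset V) :
    Finset (Finset V) :=
  H.filter (fun e => e ⊆ S)

/-- `DelProcess H D S T` : starting from the vertex set `S`, the vertex set `T` can be
reached by repeatedly deleting a vertex whose degree in the current induced
sub-hypergraph is less than `D` (together with all hyperedges containing it). -/
inductive DelProcess {V : Type*} (H : Finset (Finset V)) (D : ℕ) :
    Finset V → Finset V → Prop
  | refl (S : Finset V) : DelProcess H D S S
  | step (S T : Finset V) (v : V) (hv : v ∈ S)
      (hd : hdeg (restrictTo H S) v < D)
      (h : DelProcess H D (S.erase v) T) : DelProcess H D S T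

/-- The edge family of `H_{n,k}` for odd `k`, on vertex set `S` with kernel `A`:
all `r`-subsets of `S` having at most one vertex outside `A`. -/
noncomputable def HnkFamilyOdd {V : Type*} (r : ℕ) (S A : Finset V) : Finset (Finset V) :=
  S.powerset.filter (fun s => s.card = r ∧ (s \ A).card ≤ 1)

/-- The edge family of `H_{n,k}` for even `k`: additionally all `r`-subsets consisting of
`b1`, `b2` and `r-2` vertices of `A`. -/
noncomputable def HnkFamilyEven {V : Type*} (r : ℕ) (S A : Finset V) (b1 b2 : V) :
    Finset (Finset V) :=
  S.powerset.filter (fun s => s.card = r ∧ ((s \ A).card ≤ 1 ∨ s \ A = {b1, b2}))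

/-- `H` is (a copy of) the extremal hypergraph `H_{m,k}` on the vertex set `S`
(where `m = |S|`). Note that `⌊(k-1)/2⌋` equals `(k-1)/2` in ℕ for odd `k`,
and `(k-2)/2` for even `k`. -/
def IsHnkOn {V : Type*} (r k : ℕ) (S : Finset V) (H : Finset (Finset V)) : Prop :=
  ∃ A ⊆ S, A.card = (k - 1) / 2 ∧
    ((Odd k ∧ H = HnkFamilyOdd r S A) ∨
     (Even k ∧ ∃ b1 ∈ S \ A, ∃ b2 ∈ S \ A, b1 ≠ b2 ∧ H = HnkFamilyEven r S A b1 b2))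

/-- The extremal number of hyperedges:
`C(⌊(k-1)/2⌋, r-1)·(n − ⌊(k-1)/2⌋) + C(⌊(k-1)/2⌋, r) + [2 ∣ k]·C(⌊(k-1)/2⌋, r-2)`. -/
def extremalCount (r k n : ℕ) : ℕ :=
  ((k - 1) / 2).choose (r - 1) * (n - (k - 1) / 2) + ((k - 1) / 2).choose r +
    (if 2 ∣ k then ((k - 1) / 2).choose (r - 2) else 0)

/-- The threshold `N_{k,r}`. -/
def Nkr (r k : ℕ) : ℕ :=
  (r * (k - 1)).choose r + ((k - 1) / 2).choose (r - 1) * ((k - 1) / 2)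
    - ((k - 1) / 2).choose r - (if 2 ∣ k then ((k - 1) / 2).choose (r - 2) else 0)
    + r * (k - 1)

section NodePaths

variable {W : Type*}

/-- A list of distinct nodes, consecutive ones being adjacent. -/
def IsNodePath (G : SimpleGraph W) (l : List W) : Prop :=
  l.IsChain G.Adj ∧ l.Nodup

/-- Any two nodes of `C` are joined by a path inside `C`. -/
def PathConnected (G : SimpleGraph W) (C : Finset W) : Prop :=
  ∀ u ∈ C, ∀ v ∈ C, ∃ l, IsNodePath G l ∧ l.head? = some u ∧ l.getLast? = some v ∧ ∀ x ∈ l, x ∈ C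

/-- `C` is (the vertex set of) a connected component of `G - Z`. -/
structure IsPart (G : SimpleGraph W) (Z C : Finset W) : Prop where
  nonempty : C.Nonempty
  notMem : ∀ u ∈ C, u ∉ Z
  closed : ∀ u ∈ C, ∀ w, G.Adj u w → w ∈ C ∨ w ∈ Z
  conn : PathConnected G C

theorem IsNodePath.reverse {G : SimpleGraph W} {l : List W} (h : IsNodePath G l) :
    IsNodePath G l.reverse :=
  ⟨List.isChain_reverse.2 (h.1.imp fun _ _ hab => hab.symm), List.nodup_reverse.2 h.2⟩

theorem IsNodePath.mono {G G' : SimpleGraph W} (hG : G ≤ G') {l : List W} (h : IsNodePath G l) :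
    IsNodePath G' l :=
  ⟨h.1.imp fun _ _ hab => hG hab, h.2⟩

/-- A chain that starts in `C` and stays inside a set closed towards `C` stays in `C`. -/
theorem mem_of_isChain {G : SimpleGraph W} {C S : Finset W}
    (hC : ∀ u ∈ C, ∀ w ∈ S, G.Adj u w → w ∈ C) :
    ∀ (l : List W) (u : W), l.IsChain G.Adj → l.head? = some u → u ∈ C →
      (∀ x ∈ l, x ∈ S) → ∀ x ∈ l, x ∈ C := by
  intro l
  induction l with
  | nil => intro u _ h; simp at h
  | cons a l ih =>
    intro u hc hu huC hS x hx
    obtain rfl : a = u := by simpa using hu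
    rcases List.mem_cons.1 hx with rfl | hx
    · exact huC
    · cases l with
      | nil => simp at hx
      | cons b l =>
        rw [List.isChain_cons_cons] at hc
        exact ih b hc.2 rfl (hC a huC b (hS b (by simp)) hc.1)
          (fun y hy => hS y (List.mem_cons_of_mem _ hy)) x hx

theorem IsPart.subset_of_mem {G : SimpleGraph W} {Z C C' : Finset W} (h : IsPart G Z C)
    (h' : IsPart G Z C') {u : W} (hu : u ∈ C) (hu' : u ∈ C') : C ⊆ C' := by
  intro w hw
  obtain ⟨l, hl, hhd, hlast, hC⟩ := h.conn u hu w hw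
  refine mem_of_isChain (C := C') (S := C) ?_ l u hl.1 hhd hu' hC w (List.mem_of_getLast? hlast)
  intro x hx y hy hxy
  exact (h'.closed x hx y hxy).resolve_right (h.notMem y hy)

theorem IsPart.eq_of_mem {G : SimpleGraph W} {Z C C' : Finset W} (h : IsPart G Z C)
    (h' : IsPart G Z C') {u : W} (hu : u ∈ C) (hu' : u ∈ C') : C = C' :=
  (h.subset_of_mem h' hu hu').antisymm (h'.subset_of_mem h hu' hu)

/-- A set without edges leaving `S ∪ Z` splits into components of `G - Z`. -/
theorem exists_isPart_mem {G : SimpleGraph W} {Z S : Finset W} (hd : ∀ u ∈ S, u ∉ Z)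
    (hS : ∀ u ∈ S, ∀ w, G.Adj u w → w ∈ S ∨ w ∈ Z) {v : W} (hv : v ∈ S) :
    ∃ C, C ⊆ S ∧ IsPart G Z C ∧ v ∈ C := by
  let GS : SimpleGraph W :=
    { Adj := fun u w => G.Adj u w ∧ u ∈ S ∧ w ∈ S
      symm := ⟨fun _ _ h => ⟨h.1.symm, h.2.2, h.2.1⟩⟩
      loopless := ⟨fun _ h => G.loopless.irrefl _ h.1⟩ }
  refine ⟨S.filter (GS.Reachable v), Finset.filter_subset _ _, ?_, by simp [hv]⟩
  refine ⟨⟨v, by simp [hv]⟩, fun u hu => hd u (Finset.mem_filter.1 hu).1, ?_, ?_⟩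
  · intro u hu w huw
    rw [Finset.mem_filter] at hu
    rcases hS u hu.1 w huw with hw | hw
    · left
      have hadj : GS.Adj u w := ⟨huw, hu.1, hw⟩
      exact Finset.mem_filter.2 ⟨hw, hu.2.trans hadj.reachable⟩
    · exact Or.inr hw
  · intro u hu w hw
    rw [Finset.mem_filter] at hu hw
    obtain ⟨p, hp⟩ := (hu.2.symm.trans hw.2).exists_isPath
    refine ⟨p.support, ⟨p.isChain_adj_support.imp fun _ _ h => h.1, hp.support_nodup⟩, ?_, ?_, ?_⟩
    · rw [List.head?_eq_some_head p.support_ne_nil, p.head_support]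
    · rw [List.getLast?_eq_some_getLast p.support_ne_nil, p.getLast_support]
    · intro x hx
      have hreach : GS.Reachable u x := (p.takeUntil x hx).reachable
      refine Finset.mem_filter.2 ⟨?_, hu.2.trans hreach⟩
      have hstay : ∀ a b : W, GS.Walk a b → a ∈ S → b ∈ S := by
        intro a b q
        induction q with
        | nil => exact id
        | cons hab _ ih => exact fun _ => ih hab.2.2
      exact hstay u x (p.takeUntil x hx) hu.1

/-- A closed set either contains a large component or has many small ones. -/
theorem exists_large_part_or_many {G : SimpleGraph W} {Z S : Finset W} (hd : ∀ u ∈ S, u ∉ Z)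
    (hS : ∀ u ∈ S, ∀ w, G.Adj u w → w ∈ S ∨ w ∈ Z) {M R : ℕ} (hcard : M * R < S.card) :
    (∃ C ⊆ S, IsPart G Z C ∧ R < C.card) ∨
      ∃ F : Finset (Finset W), M ≤ F.card ∧ ∀ C ∈ F, C ⊆ S ∧ C.card ≤ R ∧ IsPart G Z C := by
  by_cases hbig : ∃ C ⊆ S, IsPart G Z C ∧ R < C.card
  · exact Or.inl hbig
  right
  push Not at hbig
  refine ⟨S.powerset.filter (IsPart G Z), ?_, ?_⟩
  · by_contra! hlt
    have hcover : S ⊆ (S.powerset.filter (IsPart G Z)).biUnion id := by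
      intro v hv
      obtain ⟨C, hCS, hC, hvC⟩ := exists_isPart_mem hd hS hv
      exact Finset.mem_biUnion.2
        ⟨C, Finset.mem_filter.2 ⟨Finset.mem_powerset.2 hCS, hC⟩, hvC⟩
    have h1 := Finset.card_le_card hcover
    have h2 := Finset.card_biUnion_le_card_mul (S.powerset.filter (IsPart G Z)) id R
      (fun C hC => by
        rw [Finset.mem_filter, Finset.mem_powerset] at hC
        exact hbig C hC.1 hC.2)
    have h3 := Nat.mul_le_mul_right R hlt.le
    omega
  · intro C hC
    rw [Finset.mem_filter, Finset.mem_powerset] at hC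
    exact ⟨hC.1, hbig C hC.1 hC.2, hC.2⟩

/-- The size beyond which a connected graph without long paths has many small parts. -/
def partBound (M : ℕ) : ℕ → ℕ
  | 0 => 0
  | h + 1 => (M + 1) * partBound M h + 1

theorem partBound_le_succ (M h : ℕ) : partBound M h ≤ partBound M (h + 1) := by
  rw [partBound]; nlinarith

/-- Every component of `S` minus `v` contains a neighbour of `v`. -/
theorem IsPart.exists_adj_of_erase {G : SimpleGraph W} {Z S C : Finset W} {v : W}
    (hS : PathConnected G S) (hv : v ∈ S) (hCS : C ⊆ S.erase v) (hSZ : ∀ u ∈ S, u ∉ Z)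
    (hC : IsPart G (insert v Z) C) : ∃ w ∈ C, G.Adj v w := by
  obtain ⟨u, hu⟩ := hC.nonempty
  have huS := Finset.mem_erase.1 (hCS hu)
  obtain ⟨l, hl, hhd, hlast, hlS⟩ := hS v hv u huS.2
  rcases l with _ | ⟨b, _ | ⟨w, l⟩⟩
  · simp at hhd
  · simp only [List.head?_cons, List.getLast?_singleton, Option.some.injEq] at hhd hlast
    exact absurd (hlast.symm.trans hhd) huS.1
  · obtain rfl : b = v := by simpa using hhd
    have hch := List.isChain_cons_cons.1 hl.1
    have hnd := List.nodup_cons.1 hl.2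
    refine ⟨w, ?_, hch.1⟩
    have hrev : (w :: l).reverse.IsChain G.Adj :=
      (IsNodePath.reverse ⟨hch.2, hnd.2⟩ : IsNodePath G _).1
    refine mem_of_isChain (C := C) (S := S.erase b) ?_ _ u hrev ?_ hu ?_ w (by simp)
    · intro x hx y hy hxy
      refine (hC.closed x hx y hxy).resolve_right fun h => ?_
      rw [Finset.mem_erase] at hy
      rcases Finset.mem_insert.1 h with h | h
      · exact hy.1 h
      · exact hSZ y hy.2 h
    · rw [List.head?_reverse]
      simpa [List.getLast?_cons_cons] using hlast
    · intro x hx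
      rw [List.mem_reverse] at hx
      refine Finset.mem_erase.2 ⟨?_, hlS x (List.mem_cons_of_mem _ hx)⟩
      rintro rfl
      exact hnd.1 hx

theorem exists_many_parts_of_isPart {G : SimpleGraph W} (M : ℕ) :
    ∀ (h : ℕ) (Z S : Finset W) (v : W), IsPart G Z S → v ∈ S →
      (∀ l, IsNodePath G l → l.head? = some v → (∀ x ∈ l, x ∈ S) → l.length ≤ h) →
      partBound M h < S.card →
      ∃ Z' : Finset W, Z'.card ≤ Z.card + h ∧ ∃ F : Finset (Finset W), M ≤ F.card ∧
        ∀ C ∈ F, C ⊆ S ∧ C.card ≤ partBound M h ∧ IsPart G Z' C := by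
  intro h
  induction h with
  | zero =>
    intro Z S v _ hv hpath _
    have := hpath [v] ⟨by simp, by simp⟩ rfl (by simpa using hv)
    simp at this
  | succ h ih =>
    intro Z S v hS hv hpath hcard
    have hcard' : M * partBound M h < (S.erase v).card := by
      rw [Finset.card_erase_of_mem hv]
      rw [partBound, add_mul] at hcard
      omega
    have hd : ∀ u ∈ S.erase v, u ∉ insert v Z := by
      intro u hu
      rw [Finset.mem_erase] at hu
      rw [Finset.mem_insert, not_or]
      exact ⟨hu.1, hS.notMem u hu.2⟩
    have hcl : ∀ u ∈ S.erase v, ∀ w, G.Adj u w → w ∈ S.erase v ∨ w ∈ insert v Z := by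
      intro u hu w huw
      by_cases hw : w = v
      · exact Or.inr (by simp [hw])
      · rcases hS.closed u (Finset.mem_of_mem_erase hu) w huw with h | h
        · exact Or.inl (Finset.mem_erase.2 ⟨hw, h⟩)
        · exact Or.inr (Finset.mem_insert_of_mem h)
    have hZ := Finset.card_insert_le v Z
    rcases exists_large_part_or_many hd hcl hcard' with ⟨C, hCS, hC, hCcard⟩ | ⟨F, hF, hFC⟩
    · obtain ⟨w, hw, hvw⟩ := hC.exists_adj_of_erase hS.conn hv hCS hS.notMem
      obtain ⟨Z', hZ', F, hF, hFC⟩ := ih (insert v Z) C w hC hw (by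
        intro l hl hhd hlC
        have hvl : v ∉ l := fun h => (Finset.mem_erase.1 (hCS (hlC v h))).1 rfl
        have hlen := hpath (v :: l) ⟨List.isChain_cons.2 ⟨by
            intro y hy
            rw [hhd, Option.mem_some_iff] at hy
            exact hy ▸ hvw, hl.1⟩, List.nodup_cons.2 ⟨hvl, hl.2⟩⟩ rfl (by
          intro x hx
          rcases List.mem_cons.1 hx with rfl | hx
          · exact hv
          · exact Finset.mem_of_mem_erase (hCS (hlC x hx)))
        simpa using hlen) hCcard
      refine ⟨Z', by omega, F, hF, fun D hD => ?_⟩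
      obtain ⟨h1, h2, h3⟩ := hFC D hD
      exact ⟨h1.trans (hCS.trans (Finset.erase_subset _ _)), h2.trans (partBound_le_succ M h), h3⟩
    · refine ⟨insert v Z, by omega, F, hF, fun D hD => ?_⟩
      obtain ⟨h1, h2, h3⟩ := hFC D hD
      exact ⟨h1.trans (Finset.erase_subset _ _), h2.trans (partBound_le_succ M h), h3⟩

/-- A large closed set without long paths has many small parts after deleting few nodes. -/
theorem exists_many_parts {G : SimpleGraph W} (M h : ℕ) (S : Finset W)
    (hS : ∀ u ∈ S, ∀ w, G.Adj u w → w ∈ S)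
    (hpath : ∀ l, IsNodePath G l → (∀ x ∈ l, x ∈ S) → l.length ≤ h)
    (hcard : partBound M (h + 1) < S.card) :
    ∃ Z : Finset W, Z.card ≤ h ∧ ∃ F : Finset (Finset W), M ≤ F.card ∧
      ∀ C ∈ F, C ⊆ S ∧ C.card ≤ partBound M (h + 1) ∧ IsPart G Z C := by
  have hcard' : M * partBound M h < S.card := by
    rw [partBound, add_mul] at hcard
    omega
  have hmono := partBound_le_succ M h
  rcases exists_large_part_or_many (Z := ∅) (by simp) (fun u hu w huw => Or.inl (hS u hu w huw))
    hcard' with ⟨C, hCS, hC, hCcard⟩ | ⟨F, hF, hFC⟩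
  · obtain ⟨v, hv⟩ := hC.nonempty
    obtain ⟨Z, hZ, F, hF, hFC⟩ := exists_many_parts_of_isPart M h ∅ C v hC hv
      (fun l hl _ hlC => hpath l hl fun x hx => hCS (hlC x hx)) hCcard
    refine ⟨Z, by simpa using hZ, F, hF, fun D hD => ?_⟩
    obtain ⟨h1, h2, h3⟩ := hFC D hD
    exact ⟨h1.trans hCS, h2.trans hmono, h3⟩
  · refine ⟨∅, by simp, F, hF, fun D hD => ?_⟩
    obtain ⟨h1, h2, h3⟩ := hFC D hD
    exact ⟨h1, h2.trans hmono, h3⟩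

end NodePaths

section Incidence

variable {V : Type*}

/-- The bipartite incidence graph of a hypergraph. -/
def incGraph (H : Finset (Finset V)) : SimpleGraph (V ⊕ Finset V) where
  Adj x y := match x, y with
    | Sum.inl v, Sum.inr e => e ∈ H ∧ v ∈ e
    | Sum.inr e, Sum.inl v => e ∈ H ∧ v ∈ e
    | _, _ => False
  symm := ⟨by rintro (v | e) (w | f) h <;> exact h⟩
  loopless := ⟨by rintro (v | e) h <;> exact h⟩

@[simp] theorem incGraph_inl_inr {H : Finset (Finset V)} {v : V} {e : Finset V} :
    (incGraph H).Adj (Sum.inl v) (Sum.inr e) ↔ e ∈ H ∧ v ∈ e := Iff.rfl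

@[simp] theorem incGraph_inr_inl {H : Finset (Finset V)} {v : V} {e : Finset V} :
    (incGraph H).Adj (Sum.inr e) (Sum.inl v) ↔ e ∈ H ∧ v ∈ e := Iff.rfl

@[simp] theorem incGraph_inl_inl {H : Finset (Finset V)} {v w : V} :
    (incGraph H).Adj (Sum.inl v) (Sum.inl w) ↔ False := Iff.rfl

@[simp] theorem incGraph_inr_inr {H : Finset (Finset V)} {e f : Finset V} :
    (incGraph H).Adj (Sum.inr e) (Sum.inr f) ↔ False := Iff.rfl

theorem incGraph_mono {H H' : Finset (Finset V)} (h : H ⊆ H') : incGraph H ≤ incGraph H' := by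
  rintro (v | e) (w | f) hadj
  · exact hadj
  · exact ⟨h hadj.1, hadj.2⟩
  · exact ⟨h hadj.1, hadj.2⟩
  · exact hadj

theorem nonempty_bergePath_of_isNodePath {H : Finset (Finset V)} {v : V}
    {l : List (V ⊕ Finset V)} (hl : IsNodePath (incGraph H) (Sum.inl v :: l)) {t : ℕ}
    (ht : 2 * t ≤ l.length) : Nonempty (BergePath H t) := by
  obtain ⟨L, hL⟩ : ∃ L, L = Sum.inl v :: l := ⟨_, rfl⟩
  rw [← hL] at hl
  have hlen : 2 * t < L.length := by rw [hL]; simp; omega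
  have hadj : ∀ i (hi : i + 1 < L.length), (incGraph H).Adj L[i] L[i + 1] :=
    fun i hi => List.isChain_iff_getElem.1 hl.1 i hi
  have heven : ∀ i : ℕ, ∀ hi : 2 * i < L.length, ∃ w, L[2 * i] = Sum.inl w := by
    intro i
    induction i with
    | zero => intro hi; exact ⟨v, by simp [hL]⟩
    | succ i ih =>
      intro hi
      obtain ⟨w, hw⟩ := ih (by omega)
      have h1 := hadj (2 * i) (by omega)
      have h2 := hadj (2 * i + 1) (by omega)
      rw [hw] at h1
      cases h3 : L[2 * i + 1] with
      | inl x => rw [h3] at h1; exact h1.elim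
      | inr e =>
        rw [h3] at h2
        cases h4 : L[2 * (i + 1)] with
        | inl x => exact ⟨x, rfl⟩
        | inr f =>
          have h5 : L[2 * i + 1 + 1] = Sum.inr f := h4
          rw [h5] at h2; exact h2.elim
  have hodd : ∀ i : ℕ, ∀ hi : 2 * i + 1 < L.length, ∃ e, L[2 * i + 1] = Sum.inr e := by
    intro i hi
    obtain ⟨w, hw⟩ := heven i (by omega)
    have h1 := hadj (2 * i) hi
    rw [hw] at h1
    cases h3 : L[2 * i + 1] with
    | inl x => rw [h3] at h1; exact h1.elim
    | inr e => exact ⟨e, rfl⟩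
  choose f hf using heven
  choose g hg using hodd
  refine ⟨⟨fun i => f i.1 (by have := i.2; omega), fun i => g i.1 (by have := i.2; omega),
    ?_, ?_, ?_, ?_, ?_⟩⟩
  · intro i j hij
    simp only at hij
    have h1 := hf i.1 (by have := i.2; omega)
    have h2 := hf j.1 (by have := j.2; omega)
    rw [hij, ← h2] at h1
    have := (List.Nodup.getElem_inj_iff hl.2).1 h1
    exact Fin.ext (by omega)
  · intro i j hij
    simp only at hij
    have h1 := hg i.1 (by have := i.2; omega)
    have h2 := hg j.1 (by have := j.2; omega)
    rw [hij, ← h2] at h1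
    have := (List.Nodup.getElem_inj_iff hl.2).1 h1
    exact Fin.ext (by omega)
  · intro i
    have h := hadj (2 * i.1) (by have := i.2; omega)
    rw [hf i.1, hg i.1] at h
    exact h.1
  · intro i
    have h := hadj (2 * i.1) (by have := i.2; omega)
    rw [hf i.1, hg i.1] at h
    exact h.2
  · intro i
    have h := hadj (2 * i.1 + 1) (by have := i.2; omega)
    have h2 := hf (i.1 + 1) (by have := i.2; omega)
    have h3 : L[2 * i.1 + 1 + 1]'(by have := i.2; omega) = _ := h2
    rw [h3, hg i.1] at h
    exact h.2

theorem IsNodePath.length_le_of_inl {H : Finset (Finset V)} {t : ℕ} (hH : IsEmpty (BergePath H t))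
    {v : V} {l : List (V ⊕ Finset V)} (hl : IsNodePath (incGraph H) (Sum.inl v :: l)) :
    l.length + 1 ≤ 2 * t := by
  by_contra! h
  exact (nonempty_bergePath_of_isNodePath hl (t := t) (by omega)).elim hH.false

theorem IsNodePath.tail {W : Type*} {G : SimpleGraph W} {x : W} {l : List W}
    (hl : IsNodePath G (x :: l)) : IsNodePath G l :=
  ⟨hl.1.tail, (List.nodup_cons.1 hl.2).2⟩

theorem IsNodePath.length_le {H : Finset (Finset V)} {t : ℕ} (hH : IsEmpty (BergePath H t))
    {l : List (V ⊕ Finset V)} (hl : IsNodePath (incGraph H) l) : l.length ≤ 2 * t + 1 := by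
  rcases l with _ | ⟨v | e, _ | ⟨w | f, l⟩⟩
  · simp
  · simp
  · exact (List.isChain_cons_cons.1 hl.1).1.elim
  · have := IsNodePath.length_le_of_inl hH hl
    simp at this ⊢; omega
  · simp
  · have := IsNodePath.length_le_of_inl hH hl.tail
    simp at this ⊢; omega
  · exact (List.isChain_cons_cons.1 hl.1).1.elim

theorem exists_isNodePath_of_reachable {W : Type*} {G : SimpleGraph W} {u v : W}
    (h : G.Reachable u v) :
    ∃ l, IsNodePath G l ∧ l.head? = some u ∧ l.getLast? = some v := by
  obtain ⟨p, hp⟩ := h.exists_isPath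
  refine ⟨p.support, ⟨p.isChain_adj_support, hp.support_nodup⟩, ?_, ?_⟩
  · rw [List.head?_eq_some_head p.support_ne_nil, p.head_support]
  · rw [List.getLast?_eq_some_getLast p.support_ne_nil, p.getLast_support]

theorem HConnected.exists_isNodePath {H : Finset (Finset V)} (hH : HConnected H) (u v : V) :
    ∃ l, IsNodePath (incGraph H) l ∧ l.head? = some (Sum.inl u) ∧
      l.getLast? = some (Sum.inl v) := by
  refine exists_isNodePath_of_reachable ?_
  rcases eq_or_ne u v with rfl | huv
  · exact SimpleGraph.Reachable.refl _
  obtain ⟨t, P, rfl, rfl⟩ := hH u v huv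
  have hstep : ∀ i : Fin (t + 1), (incGraph H).Reachable (Sum.inl (P.verts 0))
      (Sum.inl (P.verts i)) := by
    intro i
    induction i using Fin.induction with
    | zero => exact SimpleGraph.Reachable.refl _
    | succ i ih =>
      have h1 : (incGraph H).Adj (Sum.inl (P.verts i.castSucc)) (Sum.inr (P.edges i)) :=
        ⟨P.edges_mem i, P.fst_mem i⟩
      have h2 : (incGraph H).Adj (Sum.inr (P.edges i)) (Sum.inl (P.verts i.succ)) :=
        ⟨P.edges_mem i, P.snd_mem i⟩
      exact ih.trans (h1.reachable.trans h2.reachable)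
  exact hstep (Fin.last t)

end Incidence

section Tails

variable {V : Type*}

theorem card_le_choose_of_mem_of_subset {N : Finset (Finset V)} {B : Finset V} {y : V} {r m : ℕ}
    (hN : ∀ e ∈ N, e.card = r ∧ y ∈ e ∧ e ⊆ B) (hB : (B.erase y).card ≤ m) :
    N.card ≤ m.choose (r - 1) := by
  have h1 : N.card ≤ ((B.erase y).powersetCard (r - 1)).card := by
    refine Finset.card_le_card_of_injOn (fun e => e.erase y) ?_ ?_
    · intro e he
      obtain ⟨h1, h2, h3⟩ := hN e he
      simp only [Finset.mem_coe, Finset.mem_powersetCard]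
      exact ⟨Finset.erase_subset_erase _ h3, by rw [Finset.card_erase_of_mem h2, h1]⟩
    · intro e he e' he' h
      rw [← Finset.insert_erase (hN e he).2.1, ← Finset.insert_erase (hN e' he').2.1]
      simp only at h
      rw [h]
  rw [Finset.card_powersetCard] at h1
  exact h1.trans (Nat.choose_le_choose _ hB)

/-- A path leaving the vertex `α` all of whose further vertices lie in `K`. -/
def IsTail (E : Finset (Finset V)) (α : V) (K : Finset V) (l : List (V ⊕ Finset V)) : Prop :=
  IsNodePath (incGraph E) (Sum.inl α :: l) ∧ ∀ w, Sum.inl w ∈ l → w ∈ K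

/-- The vertices on a node list. -/
noncomputable def listVerts (l : List (V ⊕ Finset V)) : Finset V :=
  (l.filterMap Sum.getLeft?).toFinset

/-- The hyperedges on a node list. -/
noncomputable def listEdges (l : List (V ⊕ Finset V)) : Finset (Finset V) :=
  (l.filterMap Sum.getRight?).toFinset

@[simp] theorem mem_listVerts {l : List (V ⊕ Finset V)} {v : V} :
    v ∈ listVerts l ↔ Sum.inl v ∈ l := by
  simp [listVerts]

@[simp] theorem mem_listEdges {l : List (V ⊕ Finset V)} {e : Finset V} :
    e ∈ listEdges l ↔ Sum.inr e ∈ l := by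
  simp [listEdges]

theorem length_filterMap_of_isChain {E : Finset (Finset V)} {y : V} :
    ∀ (m : ℕ) (α : V) (l : List (V ⊕ Finset V)), l.length ≤ m →
      (Sum.inl α :: l).IsChain (incGraph E).Adj →
      (Sum.inl α :: l).getLast? = some (Sum.inl y) →
      l.length = 2 * (l.filterMap Sum.getLeft?).length ∧
        l.length = 2 * (l.filterMap Sum.getRight?).length := by
  intro m
  induction m with
  | zero =>
    intro α l hm
    obtain rfl : l = [] := List.eq_nil_of_length_eq_zero (by omega)
    simp
  | succ m ih =>
    intro α l hm hc hlast
    rcases l with _ | ⟨b | e, _ | ⟨b | f, l⟩⟩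
    · simp
    · simp at hc
    · simp at hc
    · simp at hc
    · simp at hlast
    · have hc' := (List.isChain_cons_cons.1 hc).2
      have := ih b l (by simp at hm; omega) (List.isChain_cons_cons.1 hc').2
        (by simpa [List.getLast?_cons_cons] using hlast)
      simp only [List.length_cons, List.filterMap_cons, Sum.getLeft?, Sum.getRight?]
      omega
    · simp at hc

theorem IsNodePath.card_listVerts {E : Finset (Finset V)} {α y : V} {l : List (V ⊕ Finset V)}
    (hl : IsNodePath (incGraph E) (Sum.inl α :: l))
    (hlast : (Sum.inl α :: l).getLast? = some (Sum.inl y)) :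
    l.length = 2 * (listVerts l).card ∧ l.length = 2 * (listEdges l).card := by
  have h := length_filterMap_of_isChain l.length α l le_rfl hl.1 hlast
  have hnd := (List.nodup_cons.1 hl.2).2
  rw [listVerts, listEdges, List.toFinset_card_of_nodup, List.toFinset_card_of_nodup]
  · exact h
  · refine hnd.filterMap ?_
    rintro (a | a) (b | b) c <;> simp
    rintro rfl rfl; rfl
  · refine hnd.filterMap ?_
    rintro (a | a) (b | b) c <;> simp
    rintro rfl rfl; rfl

theorem exists_max_length {W : Type*} {P : List W → Prop} {b : ℕ} (hex : ∃ l, P l)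
    (hb : ∀ l, P l → l.length ≤ b) : ∃ l, P l ∧ ∀ l', P l' → l'.length ≤ l.length := by
  obtain ⟨l0, h0⟩ := hex
  have hspec := Nat.findGreatest_spec (P := fun m => ∃ l, P l ∧ l.length = m) (hb l0 h0)
    ⟨l0, h0, rfl⟩
  obtain ⟨l, hl, hlen⟩ := hspec
  refine ⟨l, hl, fun l' hl' => ?_⟩
  rw [hlen]
  exact Nat.le_findGreatest (hb l' hl') ⟨l', hl', rfl⟩

/-- Extending a tail by one hyperedge and one vertex. -/
theorem IsTail.append {E : Finset (Finset V)} {α y z : V} {K : Finset V}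
    {l : List (V ⊕ Finset V)} (hl : IsTail E α K l)
    (hlast : (Sum.inl α :: l).getLast? = some (Sum.inl y)) {g : Finset V} (hg : g ∈ E)
    (hyg : y ∈ g) (hzg : z ∈ g) (hgl : Sum.inr g ∉ l) (hzl : Sum.inl z ∉ l) (hzα : z ≠ α)
    (hzK : z ∈ K) : IsTail E α K (l ++ [Sum.inr g, Sum.inl z]) := by
  refine ⟨⟨?_, ?_⟩, ?_⟩
  · rw [← List.cons_append, List.isChain_append]
    refine ⟨hl.1.1, by simp [hg, hzg], ?_⟩
    intro x hx w hw
    rw [hlast] at hx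
    simp only [Option.mem_def, Option.some.injEq, List.head?_cons] at hx hw
    subst hx; subst hw
    exact ⟨hg, hyg⟩
  · have := hl.1.2
    rw [List.nodup_cons] at this ⊢
    refine ⟨by simp [this.1, hzα.symm], ?_⟩
    rw [List.nodup_append']
    refine ⟨this.2, by simp, ?_⟩
    simp [hgl, hzl]
  · intro w hw
    simp only [List.mem_append, List.mem_cons, reduceCtorEq, Sum.inl.injEq, List.not_mem_nil,
      or_false, false_or] at hw
    rcases hw with hw | rfl
    · exact hl.2 w hw
    · exact hzK

/-- Pósa rotation of a tail, followed by an extension. -/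
theorem IsTail.rotate {E : Finset (Finset V)} {α p y z : V} {K : Finset V}
    {l₁ l₂ : List (V ⊕ Finset V)} {f g : Finset V} (hl : IsTail E α K (l₁ ++ Sum.inr f :: l₂))
    (hp : (Sum.inl α :: l₁).getLast? = some (Sum.inl p)) (hy : l₂.getLast? = some (Sum.inl y))
    (hg : g ∈ E) (hpg : p ∈ g) (hyg : y ∈ g) (hgl : Sum.inr g ∉ l₁ ++ Sum.inr f :: l₂)
    (hzf : z ∈ f) (hzl : Sum.inl z ∉ l₁ ++ Sum.inr f :: l₂) (hzα : z ≠ α) (hzK : z ∈ K) :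
    IsTail E α K (l₁ ++ Sum.inr g :: (l₂.reverse ++ [Sum.inr f, Sum.inl z])) := by
  have hch := hl.1.1
  rw [← List.cons_append, List.isChain_append] at hch
  obtain ⟨hc1, hc2, hc3⟩ := hch
  have hfE : f ∈ E := by
    have := hc3 _ hp (Sum.inr f) (by simp)
    exact this.1
  rw [List.isChain_cons] at hc2
  refine ⟨⟨?_, ?_⟩, ?_⟩
  · rw [← List.cons_append, List.isChain_append]
    refine ⟨hc1, ?_, ?_⟩
    · rw [List.isChain_cons, List.isChain_append]
      refine ⟨?_, List.isChain_reverse.2 (hc2.2.imp fun _ _ h => h.symm), by simp [hfE, hzf], ?_⟩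
      · intro x hx
        rw [List.head?_append, List.head?_reverse, hy] at hx
        simp only [Option.some_or, Option.mem_def, Option.some.injEq] at hx
        subst hx
        exact ⟨hg, hyg⟩
      · intro x hx w hw
        rw [List.getLast?_reverse] at hx
        simp only [Option.mem_def, Option.some.injEq, List.head?_cons] at hw
        subst hw
        exact (hc2.1 x hx).symm
    · intro x hx w hw
      rw [hp] at hx
      simp only [Option.mem_def, Option.some.injEq, List.head?_cons] at hx hw
      subst hx; subst hw
      exact ⟨hg, hpg⟩
  · have hnd := hl.1.2
    have hperm : (Sum.inl α :: (l₁ ++ Sum.inr g :: (l₂.reverse ++ [Sum.inr f, Sum.inl z]))).Perm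
        (Sum.inl α :: ((l₁ ++ Sum.inr f :: l₂) ++ [Sum.inr g, Sum.inl z])) := by
      refine List.Perm.cons _ ?_
      rw [List.append_assoc]
      refine List.Perm.append_left _ ?_
      have h1 : (l₂.reverse ++ [Sum.inr f, Sum.inl z]).Perm (Sum.inr f :: l₂ ++ [Sum.inl z]) := by
        refine (List.Perm.append_right _ (List.reverse_perm l₂)).trans ?_
        exact List.perm_middle
      refine (List.Perm.cons _ h1).trans ?_
      exact (List.perm_middle (l₁ := Sum.inr f :: l₂)).symm
    rw [hperm.nodup_iff]
    rw [List.nodup_cons] at hnd ⊢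
    refine ⟨by simpa [hzα.symm] using hnd.1, ?_⟩
    rw [List.nodup_append']
    refine ⟨hnd.2, by simp, ?_⟩
    simp only [List.disjoint_cons_right, List.disjoint_nil_right, and_true]
    exact ⟨hgl, hzl⟩
  · intro w hw
    simp only [List.mem_append, List.mem_cons, reduceCtorEq, Sum.inl.injEq, List.not_mem_nil,
      or_false, false_or, List.mem_reverse] at hw
    rcases hw with hw | hw | rfl
    · exact hl.2 w (by simp [hw])
    · exact hl.2 w (by simp [hw])
    · exact hzK

end Tails

section LongTail

variable {V : Type*}

theorem le_choose_of_two_mul_le {r a : ℕ} (hr : 4 ≤ r) (ha : 2 * r ≤ a + 1) :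
    a ≤ (a - 1).choose (r - 2) := by
  have hmono : ∀ j, 2 ≤ j → j ≤ r - 2 → (a - 1).choose 2 ≤ (a - 1).choose j := by
    intro j hj
    induction j, hj using Nat.le_induction with
    | base => intro _; exact le_rfl
    | succ j hj ih =>
      intro hjr
      exact (ih (by omega)).trans (Nat.choose_le_succ_of_lt_half_left (by omega))
  refine le_trans ?_ (hmono (r - 2) (by omega) le_rfl)
  obtain ⟨b, rfl⟩ : ∃ b, a = b + 7 := ⟨a - 7, by omega⟩
  rw [Nat.choose_two_right, Nat.le_div_iff_mul_le (by norm_num)]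
  have : b + 7 - 1 - 1 = b + 5 := by omega
  rw [this]
  have : b + 7 - 1 = b + 6 := by omega
  rw [this]
  nlinarith

/-- Splitting a tail at one of its hyperedges: the preceding node is a vertex of that edge. -/
theorem IsTail.exists_pred {E : Finset (Finset V)} {α : V} {K : Finset V}
    {l₁ l₂ : List (V ⊕ Finset V)} {f : Finset V} (hl : IsTail E α K (l₁ ++ Sum.inr f :: l₂)) :
    ∃ p, (Sum.inl α :: l₁).getLast? = some (Sum.inl p) ∧ p ∈ f := by
  have hch := hl.1.1
  rw [← List.cons_append, List.isChain_append] at hch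
  obtain ⟨_, _, hc3⟩ := hch
  have hne : (Sum.inl α :: l₁) ≠ [] := by simp
  have h := List.getLast?_eq_some_getLast hne
  have hadj := hc3 _ h (Sum.inr f) (by simp)
  cases hx : (Sum.inl α :: l₁).getLast hne with
  | inl p => rw [hx] at h hadj; exact ⟨p, h, hadj.2⟩
  | inr e => rw [hx] at hadj; exact hadj.elim

theorem eq_nil_of_getLast?_cons {W : Type*} {x : W} {t : List W} (hnd : (x :: t).Nodup)
    (h : (x :: t).getLast? = some x) : t = [] := by
  by_contra hne
  rw [List.getLast?_cons_of_ne_nil hne] at h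
  exact (List.nodup_cons.1 hnd).1 (List.mem_of_getLast? h)

/-- A minimum degree condition forces a long tail. -/
theorem exists_long_tail {E : Finset (Finset V)} {r a : ℕ} (hr : 3 ≤ r) (ha : 2 * r ≤ a + 1)
    (hE : ∀ e ∈ E, e.card = r) {α : V} {K X T : Finset V} (hαK : α ∉ K) (hXa : X.card ≤ a) (hTK : T ⊆ K)
    (hdeg : ∀ v ∈ T, a.choose (r - 1) < (E.filter fun e => v ∈ e ∧ e ⊆ T ∪ X).card)
    (hex : ∃ l, IsTail E α K l ∧ ∃ y ∈ T, l.getLast? = some (Sum.inl y)) :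
    ∃ l, IsTail E α K l ∧ (∃ y ∈ T, l.getLast? = some (Sum.inl y)) ∧
      2 * (a - X.card) + 4 ≤ l.length := by
  by_contra! hshort
  obtain ⟨l, ⟨hl, y, hyT, hlast⟩, hmax⟩ := exists_max_length (b := 2 * (a - X.card) + 4) hex
    (fun l hl => (hshort l hl.1 hl.2).le)
  have hlne : l ≠ [] := by rintro rfl; simp at hlast
  have hlast' : (Sum.inl α :: l).getLast? = some (Sum.inl y) := by
    rw [List.getLast?_cons_of_ne_nil hlne]; exact hlast
  obtain ⟨hYcard, hFcard⟩ := hl.1.card_listVerts hlast'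
  have hlen := hshort l hl ⟨y, hyT, hlast⟩
  set Y := listVerts l with hY
  have hyY : y ∈ Y := by simpa [hY] using List.mem_of_getLast? hlast
  have hXY : (X ∪ Y).card ≤ a + 1 := by
    have := Finset.card_union_le X Y
    omega
  have hNmem : ∀ e, e ∈ (E.filter fun e => y ∈ e ∧ e ⊆ T ∪ X) → e ∈ E ∧ y ∈ e ∧ e ⊆ T ∪ X :=
    fun e he => by simpa using he
  have hN := hdeg y hyT
  set N := E.filter fun e => y ∈ e ∧ e ⊆ T ∪ X with hNdef
  have hTα : ∀ z ∈ T, z ≠ α := by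
    rintro z hz rfl
    exact hαK (hTK hz)
  have hout : ∀ g ∈ N, ∀ z ∈ g, z ∉ X ∪ Y → z ∈ T ∧ Sum.inl z ∉ l ∧ z ≠ α := by
    intro g hg z hz hzXY
    rw [Finset.mem_union, not_or] at hzXY
    have hzT : z ∈ T := by
      rcases Finset.mem_union.1 ((hNmem g hg).2.2 hz) with h | h
      · exact h
      · exact absurd h hzXY.1
    exact ⟨hzT, by simpa [hY] using hzXY.2, hTα z hzT⟩
  have hnew : ∀ g ∈ N, Sum.inr g ∉ l → g ⊆ X ∪ Y := by
    intro g hg hgl z hz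
    by_contra hzXY
    obtain ⟨hzT, hzl, hzα⟩ := hout g hg z hz hzXY
    have h1 := hl.append hlast' (hNmem g hg).1 (hNmem g hg).2.1 hz hgl hzl hzα (hTK hzT)
    have h2 := hmax _ ⟨h1, z, hzT, by simp⟩
    simp at h2
  have hinner : ∀ p, p ∈ T ∪ X → Sum.inl p ∈ Sum.inl α :: l → p ∈ X ∪ Y := by
    intro p hp hpl
    rcases Finset.mem_union.1 hp with h | h
    · rw [List.mem_cons] at hpl
      rcases hpl with hpl | hpl
      · exact absurd (Sum.inl.inj hpl) (hTα p h)
      · exact Finset.mem_union_right _ (by simpa [hY] using hpl)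
    · exact Finset.mem_union_left _ h
  obtain ⟨f, hfN, hfXY⟩ : ∃ f ∈ N, ¬ f ⊆ X ∪ Y := by
    by_contra! hall
    have := card_le_choose_of_mem_of_subset (N := N) (B := X ∪ Y) (y := y) (r := r) (m := a)
      (fun e he => ⟨hE e (hNmem e he).1, (hNmem e he).2.1, hall e he⟩)
      (by rw [Finset.card_erase_of_mem (Finset.mem_union_right _ hyY)]; omega)
    omega
  obtain ⟨z, hzf, hzXY⟩ := Finset.not_subset.1 hfXY
  obtain ⟨hzT, hzl, hzα⟩ := hout f hfN z hzf hzXY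
  have hfl : Sum.inr f ∈ l := by
    by_contra h
    exact hfXY (hnew f hfN h)
  obtain ⟨l₁, l₂, hsplit⟩ := List.append_of_mem hfl
  have hl' := hl
  rw [hsplit] at hl'
  obtain ⟨p, hp, hpf⟩ := hl'.exists_pred
  have hl₂ : l₂.getLast? = some (Sum.inl y) := by
    rw [hsplit] at hlast
    rcases l₂ with _ | ⟨b, l₂⟩
    · simp at hlast
    · simpa [List.getLast?_append, List.getLast?_cons_cons] using hlast
  have hpmem : Sum.inl p ∈ Sum.inl α :: l₁ := List.mem_of_getLast? hp
  have hyl₂ : Sum.inl y ∈ l₂ := List.mem_of_getLast? hl₂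
  have hnd : (Sum.inl α :: l₁ ++ Sum.inr f :: l₂).Nodup := hl'.1.2
  have hpy : p ≠ y := by
    rintro rfl
    exact (List.nodup_append'.1 hnd).2.2 hpmem (List.mem_cons_of_mem _ hyl₂)
  have hpXY : p ∈ X ∪ Y := by
    refine hinner p ((hNmem f hfN).2.2 hpf) ?_
    rw [hsplit]
    rw [List.mem_cons] at hpmem ⊢
    rcases hpmem with h | h
    · exact Or.inl h
    · exact Or.inr (List.mem_append_left _ h)
  have hrot : ∀ g ∈ N, Sum.inr g ∉ l → p ∉ g := by
    intro g hg hgl hpg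
    rw [hsplit] at hgl hzl
    have h1 := hl'.rotate hp hl₂ (hNmem g hg).1 hpg (hNmem g hg).2.1 hgl hzf hzl hzα (hTK hzT)
    have h2 := hmax _ ⟨h1, z, hzT, by
      rw [show l₁ ++ Sum.inr g :: (l₂.reverse ++ [Sum.inr f, Sum.inl z]) =
        (l₁ ++ Sum.inr g :: l₂.reverse ++ [Sum.inr f]) ++ [Sum.inl z] by simp]
      exact List.getLast?_concat⟩
    rw [hsplit] at h2
    simp at h2
  set B := N.filter fun e => ¬ e ⊆ (X ∪ Y).erase p with hBdef
  have hBl : B ⊆ listEdges l := by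
    intro e he
    rw [hBdef, Finset.mem_filter] at he
    rw [mem_listEdges]
    by_contra hel
    refine he.2 fun w hw => Finset.mem_erase.2 ⟨?_, hnew e he.1 hel hw⟩
    rintro rfl
    exact hrot e he.1 hel hw
  have hgood : (N.filter fun e => e ⊆ (X ∪ Y).erase p).card ≤ (a - 1).choose (r - 1) := by
    refine card_le_choose_of_mem_of_subset (B := (X ∪ Y).erase p) (y := y) ?_ ?_
    · intro e he
      rw [Finset.mem_filter] at he
      exact ⟨hE e (hNmem e he.1).1, (hNmem e he.1).2.1, he.2⟩
    · rw [Finset.card_erase_of_mem (Finset.mem_erase.2 ⟨hpy.symm, Finset.mem_union_right _ hyY⟩),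
        Finset.card_erase_of_mem hpXY]
      omega
  have hsum : (N.filter fun e => e ⊆ (X ∪ Y).erase p).card + B.card = N.card :=
    Finset.card_filter_add_card_filter_not _
  have hpascal : a.choose (r - 1) = (a - 1).choose (r - 2) + (a - 1).choose (r - 1) := by
    obtain ⟨b, rfl⟩ : ∃ b, a = b + 1 := ⟨a - 1, by omega⟩
    obtain ⟨t, rfl⟩ : ∃ t, r = t + 2 := ⟨r - 2, by omega⟩
    simp [Nat.choose_succ_succ]
  suffices hB : B.card ≤ (a - 1).choose (r - 2) by omega
  rcases Nat.lt_or_ge 3 r with hr4 | hr3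
  · refine le_trans ?_ (le_choose_of_two_mul_le hr4 ha)
    have hB1 := Finset.card_le_card hBl
    rcases Nat.eq_zero_or_pos X.card with hX0 | hX1
    · have hX : X = ∅ := Finset.card_eq_zero.1 hX0
      obtain ⟨e₀, l₀, hl₀⟩ : ∃ e₀ l₀, l = Sum.inr e₀ :: l₀ := by
        rcases l with _ | ⟨b | e₀, l₀⟩
        · exact absurd rfl hlne
        · exact (List.isChain_cons_cons.1 hl.1.1).1.elim
        · exact ⟨e₀, l₀, rfl⟩
      have hαe : α ∈ e₀ := by
        have := hl.1.1
        rw [hl₀] at this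
        exact (List.isChain_cons_cons.1 this).1.2
      have hBe : B ⊆ (listEdges l).erase e₀ := by
        intro e he
        refine Finset.mem_erase.2 ⟨?_, hBl he⟩
        rintro rfl
        have heN := (Finset.mem_filter.1 he).1
        have := (hNmem e heN).2.2 hαe
        rw [hX, Finset.union_empty] at this
        exact hTα α this rfl
      have h2 := Finset.card_le_card hBe
      rw [Finset.card_erase_of_mem (by simp [hl₀])] at h2
      omega
    · omega
  · obtain rfl : r = 3 := by omega
    have hpyz : ({p, y, z} : Finset V) = f := by
      refine Finset.eq_of_subset_of_card_le ?_ ?_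
      · intro w hw
        simp only [Finset.mem_insert, Finset.mem_singleton] at hw
        rcases hw with rfl | rfl | rfl
        · exact hpf
        · exact (hNmem f hfN).2.1
        · exact hzf
      · rw [hE f (hNmem f hfN).1, Finset.card_eq_three.2 ⟨p, y, z, hpy, ?_, ?_, rfl⟩]
        · rintro rfl; exact hzXY hpXY
        · rintro rfl; exact hzXY (Finset.mem_union_right _ hyY)
    have huniq : ∀ e ∈ B.erase f, ∃ m, l₁ = m ++ [Sum.inr e, Sum.inl p] := by
      have hl₂eq : l₂ = [Sum.inl y] := by
        rcases l₂ with _ | ⟨b, l₃⟩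
        · simp at hl₂
        have hadj : (incGraph E).Adj (Sum.inr f) b := by
          have h := hl'.1.1
          rw [← List.cons_append, List.isChain_append] at h
          exact (List.isChain_cons_cons.1 h.2.1).1
        rcases b with w | b
        swap
        · exact hadj.elim
        have hw : w ∈ ({p, y, z} : Finset V) := hpyz ▸ hadj.2
        simp only [Finset.mem_insert, Finset.mem_singleton] at hw
        have hnd' := List.nodup_append'.1 hnd
        rcases hw with rfl | rfl | rfl
        · exact absurd (List.mem_cons_of_mem _ List.mem_cons_self) (hnd'.2.2 hpmem)
        · rw [eq_nil_of_getLast?_cons (List.nodup_cons.1 hnd'.2.1).2 hl₂]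
        · exact absurd (by simp [hsplit]) hzl
      intro e he
      rw [Finset.mem_erase] at he
      have heB := Finset.mem_filter.1 he.2
      have hel := mem_listEdges.1 (hBl he.2)
      rw [hsplit, hl₂eq] at hel
      have hel₁ : Sum.inr e ∈ l₁ := by simpa [he.1] using hel
      obtain ⟨m, m₂, hm⟩ := List.append_of_mem hel₁
      have hl'' : IsTail E α K (m ++ Sum.inr e :: (m₂ ++ Sum.inr f :: l₂)) := by
        simpa [hm] using hl'
      obtain ⟨q, hq, hqe⟩ := hl''.exists_pred
      have hqmem := List.mem_of_getLast? hq
      rcases m₂ with _ | ⟨b, m₃⟩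
      · rw [hm, ← List.cons_append, List.getLast?_concat] at hp
        simp at hp
      have hadj : (incGraph E).Adj (Sum.inr e) b := by
        have h := hl''.1.1
        rw [← List.cons_append, List.isChain_append] at h
        exact (List.isChain_cons_cons.1 h.2.1).1
      rcases b with w | b
      swap
      · exact hadj.elim
      have hndm : (Sum.inl α :: m ++ Sum.inr e :: (Sum.inl w :: m₃ ++ Sum.inr f :: l₂)).Nodup :=
        hl''.1.2
      have hdisj := (List.nodup_append'.1 hndm).2.2
      have hqw : q ≠ w := by
        rintro rfl
        exact hdisj hqmem (by simp)
      have hqy : q ≠ y := by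
        rintro rfl
        exact hdisj hqmem (by simp [hl₂eq])
      have hwy : w ≠ y := by
        rintro rfl
        have h := (List.nodup_cons.1 (List.nodup_append'.1 hndm).2.1).2
        rw [List.cons_append, List.nodup_cons] at h
        exact h.1 (by simp [hl₂eq])
      have heq : ({q, w, y} : Finset V) = e := by
        refine Finset.eq_of_subset_of_card_le ?_ ?_
        · intro t ht
          simp only [Finset.mem_insert, Finset.mem_singleton] at ht
          rcases ht with rfl | rfl | rfl
          · exact hqe
          · exact hadj.2
          · exact (hNmem e heB.1).2.1
        · rw [hE e (hNmem e heB.1).1, Finset.card_eq_three.2 ⟨q, w, y, hqw, hqy, hwy, rfl⟩]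
      have hqXY : q ∈ X ∪ Y := by
        refine hinner q ((hNmem e heB.1).2.2 hqe) ?_
        rw [List.mem_cons] at hqmem ⊢
        refine hqmem.imp_right fun h => ?_
        rw [hsplit, hm]
        simp [h]
      have hwXY : w ∈ X ∪ Y := Finset.mem_union_right _ (by simp [hY, hsplit, hm])
      have hlastm : (Sum.inl w :: m₃).getLast? = some (Sum.inl p) := by
        rw [hm, ← List.cons_append, List.getLast?_append] at hp
        simpa [List.getLast?_cons_cons] using hp
      have hpqw : p = q ∨ p = w := by
        obtain ⟨t, hte, ht⟩ := Finset.not_subset.1 heB.2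
        rw [← heq] at hte
        simp only [Finset.mem_insert, Finset.mem_singleton] at hte
        rw [Finset.mem_erase, not_and_or, not_not] at ht
        rcases hte with rfl | rfl | rfl
        · exact Or.inl (ht.resolve_right fun h => h hqXY).symm
        · exact Or.inr (ht.resolve_right fun h => h hwXY).symm
        · exact absurd (ht.resolve_right fun h => h (Finset.mem_union_right _ hyY)).symm hpy
      rcases hpqw with rfl | rfl
      · have h := List.mem_of_getLast? hlastm
        refine absurd ?_ (hdisj hqmem)
        exact List.mem_cons_of_mem _ (List.mem_append_left _ h)
      · refine ⟨m, ?_⟩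
        rw [hm, eq_nil_of_getLast?_cons ?_ hlastm]
        have h := (List.nodup_cons.1 (List.nodup_append'.1 hndm).2.1).2
        exact (List.nodup_append'.1 h).1
    have hle : (B.erase f).card ≤ 1 := by
      rw [Finset.card_le_one]
      intro e he e' he'
      obtain ⟨m, hm⟩ := huniq e he
      obtain ⟨m', hm'⟩ := huniq e' he'
      rw [hm] at hm'
      have h1 : (m ++ [Sum.inr e] ++ [Sum.inl p] : List (V ⊕ Finset V))
        = m' ++ [Sum.inr e'] ++ [Sum.inl p] := by simpa using hm'
      have h3 := List.append_inj_left' h1 rfl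
      have h4 := List.append_inj_right' h3 rfl
      simpa using h4
    have := Finset.pred_card_le_card_erase (s := B) (a := f)
    simp
    omega

end LongTail

section Core

variable {V : Type*}

/-- The hyperedges inside `T ∪ X` that meet `T`. -/
noncomputable def edgesMeeting (E : Finset (Finset V)) (X T : Finset V) : Finset (Finset V) :=
  E.filter fun e => e ⊆ T ∪ X ∧ ∃ v ∈ T, v ∈ e

/-- A vertex set meeting many hyperedges contains one of large minimum degree. -/
theorem exists_core {E : Finset (Finset V)} {K X : Finset V} {r D : ℕ} {c : ℤ}
    (hE : ∀ e ∈ E, e.card = r) (hK : K.Nonempty)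
    (hcard : (D : ℤ) * K.card + c ≤ (edgesMeeting E X K).card)
    (hX : (X.card.choose (r - 1) : ℤ) < D + c) :
    ∃ T ⊆ K, T.Nonempty ∧ (D : ℤ) * T.card + c ≤ (edgesMeeting E X T).card ∧
      ∀ v ∈ T, D < (E.filter fun e => v ∈ e ∧ e ⊆ T ∪ X).card := by
  obtain ⟨T, hT, hmin⟩ := Finset.exists_min_image
    (K.powerset.filter fun T => T.Nonempty ∧ (D : ℤ) * T.card + c ≤ (edgesMeeting E X T).card)
    Finset.card ⟨K, by simp [hK, hcard]⟩
  simp only [Finset.mem_filter, Finset.mem_powerset] at hT hmin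
  obtain ⟨hTK, hTne, hTcard⟩ := hT
  refine ⟨T, hTK, hTne, hTcard, fun v hv => ?_⟩
  have hsub : edgesMeeting E X T ⊆ edgesMeeting E X (T.erase v) ∪
      E.filter fun e => v ∈ e ∧ e ⊆ T ∪ X := by
    intro e he
    simp only [edgesMeeting, Finset.mem_filter, Finset.mem_union] at he ⊢
    obtain ⟨heE, heT, w, hwT, hwe⟩ := he
    by_cases hve : v ∈ e
    · exact Or.inr ⟨heE, hve, heT⟩
    · refine Or.inl ⟨heE, fun t ht => ?_, w, ?_, hwe⟩
      · have htv : t ≠ v := fun h => hve (h ▸ ht)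
        have := heT ht
        simp only [Finset.mem_union, Finset.mem_erase] at this ⊢
        tauto
      · exact Finset.mem_erase.2 ⟨fun h => hve (h ▸ hwe), hwT⟩
  have hle := (Finset.card_le_card hsub).trans (Finset.card_union_le _ _)
  have hTpos : 0 < T.card := Finset.card_pos.2 hTne
  rcases (T.erase v).eq_empty_or_nonempty with hem | hne
  · exfalso
    have h0 : (edgesMeeting E X (T.erase v)).card = 0 := by
      rw [hem, edgesMeeting]; simp
    have h1 : T.card = 1 := by
      have := Finset.card_erase_of_mem hv
      rw [hem, Finset.card_empty] at this
      omega
    have h2 : (E.filter fun e => v ∈ e ∧ e ⊆ T ∪ X).card ≤ X.card.choose (r - 1) := by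
      refine card_le_choose_of_mem_of_subset (B := T ∪ X) (y := v) ?_ ?_
      · intro e he
        rw [Finset.mem_filter] at he
        exact ⟨hE e he.1, he.2⟩
      · rw [Finset.erase_union_distrib, hem, Finset.empty_union]
        exact Finset.card_le_card (Finset.erase_subset _ _)
    rw [h1] at hTcard
    push_cast at hTcard
    have h3 : ((edgesMeeting E X T).card : ℤ) ≤ X.card.choose (r - 1) := by
      exact_mod_cast (by omega : (edgesMeeting E X T).card ≤ X.card.choose (r - 1))
    linarith
  · have h1 : ¬ ((D : ℤ) * (T.erase v).card + c ≤ (edgesMeeting E X (T.erase v)).card) := by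
      intro h
      have := hmin (T.erase v) ⟨(Finset.erase_subset _ _).trans hTK, hne, h⟩
      rw [Finset.card_erase_of_mem hv] at this
      omega
    rw [Finset.card_erase_of_mem hv, Nat.cast_sub hTpos] at h1
    push_cast at h1
    have h2 : ((edgesMeeting E X T).card : ℤ) ≤ (edgesMeeting E X (T.erase v)).card +
      (E.filter fun e => v ∈ e ∧ e ⊆ T ∪ X).card := by exact_mod_cast hle
    have h3 : (D : ℤ) < (E.filter fun e => v ∈ e ∧ e ⊆ T ∪ X).card := by linarith
    exact_mod_cast h3

end Core

section Chaining

variable {V : Type*}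

/-- `C` contains paths on at least three nodes between any two vertices of `A`. -/
def Links (H : Finset (Finset V)) (A : Finset V) (C : Finset (V ⊕ Finset V)) : Prop :=
  (∀ α ∈ A, Sum.inl α ∉ C) ∧ ∀ α ∈ A, ∀ β ∈ A, α ≠ β →
    ∃ l : List (V ⊕ Finset V), 3 ≤ l.length ∧ l.Nodup ∧ (∀ x ∈ l, x ∈ C) ∧
      (Sum.inl α :: (l ++ [Sum.inl β])).IsChain (incGraph H).Adj

theorem exists_path_through {H : Finset (Finset V)} {A : Finset V} :
    ∀ (L : List V) (α β : V) (F : Finset (Finset (V ⊕ Finset V))), (α :: L).Nodup →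
      (α :: L).getLast? = some β → (∀ γ ∈ α :: L, γ ∈ A) → L.length ≤ F.card →
      (∀ C ∈ F, Links H A C) → (∀ C ∈ F, ∀ C' ∈ F, ∀ x ∈ C, x ∈ C' → C = C') →
      ∃ p, IsNodePath (incGraph H) (Sum.inl α :: p) ∧
        (Sum.inl α :: p).getLast? = some (Sum.inl β) ∧ 4 * L.length ≤ p.length ∧
        ∀ x ∈ p, (∃ γ ∈ L, x = Sum.inl γ) ∨ ∃ C ∈ F, x ∈ C := by
  intro L
  induction L with
  | nil =>
    intro α β F _ hlast _ _ _ _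
    obtain rfl : α = β := by simpa using hlast
    exact ⟨[], ⟨by simp, by simp⟩, rfl, by simp, by simp⟩
  | cons γ L ih =>
    intro α β F hnd hlast hA hF hlinks hdisj
    obtain ⟨C, hC⟩ : F.Nonempty := Finset.card_pos.1 (by simp at hF; omega)
    obtain ⟨p, hp, hplast, hplen, hpmem⟩ := ih γ β (F.erase C) (List.nodup_cons.1 hnd).2
      (by simpa [List.getLast?_cons_cons] using hlast)
      (fun δ hδ => hA δ (List.mem_cons_of_mem _ hδ))
      (by rw [Finset.card_erase_of_mem hC]; simp at hF; omega)
      (fun C' hC' => hlinks C' (Finset.mem_of_mem_erase hC'))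
      (fun C₁ h₁ C₂ h₂ => hdisj C₁ (Finset.mem_of_mem_erase h₁) C₂ (Finset.mem_of_mem_erase h₂))
    have hαγ : α ≠ γ := fun h => (List.nodup_cons.1 hnd).1 (by simp [h])
    obtain ⟨hCA, hlink⟩ := hlinks C hC
    obtain ⟨l, hl3, hlnd, hlC, hlch⟩ := hlink α (hA α (by simp)) γ (hA γ (by simp)) hαγ
    have hpC : ∀ x ∈ Sum.inl γ :: p, x ∉ C := by
      intro x hx hxC
      rcases List.mem_cons.1 hx with rfl | hx
      · exact hCA γ (hA γ (by simp)) hxC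
      rcases hpmem x hx with ⟨δ, hδ, rfl⟩ | ⟨C', hC', hxC'⟩
      · exact hCA δ (hA δ (by simp [hδ])) hxC
      · rw [Finset.mem_erase] at hC'
        exact hC'.1 (hdisj C' hC'.2 C hC x hxC' hxC)
    refine ⟨l ++ Sum.inl γ :: p, ⟨?_, ?_⟩, ?_, ?_, ?_⟩
    · have h1 := hlch
      rw [← List.cons_append, List.isChain_append] at h1 ⊢
      exact ⟨h1.1, hp.1, fun x hx y hy => h1.2.2 x hx y (by simpa using hy)⟩
    · rw [List.nodup_cons, List.nodup_append']
      refine ⟨?_, hlnd, hp.2, fun x hxl hxp => hpC x hxp (hlC x hxl)⟩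
      rw [List.mem_append, not_or]
      refine ⟨fun h => hCA α (hA α (by simp)) (hlC _ h), fun h => ?_⟩
      rcases List.mem_cons.1 h with h | h
      · exact hαγ (Sum.inl.inj h)
      rcases hpmem _ h with ⟨δ, hδ, h⟩ | ⟨C', hC', hxC'⟩
      · rw [Sum.inl.inj h] at hnd
        exact (List.nodup_cons.1 hnd).1 (by simp [hδ])
      · exact (hlinks C' (Finset.mem_of_mem_erase hC')).1 α (hA α (by simp)) hxC'
    · rw [← List.cons_append, List.getLast?_append, hplast]
      rfl
    · simp only [List.length_append, List.length_cons]
      omega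
    · intro x hx
      rcases List.mem_append.1 hx with hx | hx
      · exact Or.inr ⟨C, hC, hlC x hx⟩
      rcases List.mem_cons.1 hx with rfl | hx
      · exact Or.inl ⟨γ, by simp, rfl⟩
      rcases hpmem x hx with ⟨δ, hδ, rfl⟩ | ⟨C', hC', hxC'⟩
      · exact Or.inl ⟨δ, by simp [hδ], rfl⟩
      · exact Or.inr ⟨C', Finset.mem_of_mem_erase hC', hxC'⟩

theorem exists_list_first_last {A : Finset V} {α β : V} (hα : α ∈ A) (hβ : β ∈ A)
    (h : α = β → A = {α}) :
    ∃ L : List V, (α :: L).Nodup ∧ (α :: L).getLast? = some β ∧ (∀ γ ∈ α :: L, γ ∈ A) ∧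
      L.length + 1 = A.card := by
  by_cases hαβ : α = β
  · subst hαβ
    rw [h rfl]
    exact ⟨[], by simp⟩
  · have hβ' : β ∈ A.erase α := Finset.mem_erase.2 ⟨Ne.symm hαβ, hβ⟩
    have h1 := Finset.card_erase_of_mem hα
    have h2 := Finset.card_erase_of_mem hβ'
    have h3 := Finset.card_pos.2 ⟨β, hβ'⟩
    refine ⟨((A.erase α).erase β).toList ++ [β], ?_, ?_, ?_, ?_⟩
    · rw [List.nodup_cons, List.nodup_append']
      refine ⟨by simp [hαβ], Finset.nodup_toList _, by simp, ?_⟩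
      simp
    · rw [← List.cons_append]; exact List.getLast?_concat
    · intro γ hγ
      simp only [List.mem_cons, List.mem_append, Finset.mem_toList, Finset.mem_erase,
        List.not_mem_nil, or_false] at hγ
      rcases hγ with rfl | hγ | rfl
      · exact hα
      · exact hγ.2.2
      · exact hβ
    · simp only [List.length_append, Finset.length_toList, List.length_cons, List.length_nil]
      omega

/-- Two disjoint tails can be joined through all vertices of `A`. -/
theorem length_add_length_le_of_links {H : Finset (Finset V)} {k : ℕ}
    (hH : IsEmpty (BergePath H k)) {A : Finset V} {F : Finset (Finset (V ⊕ Finset V))}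
    (hlinks : ∀ C ∈ F, Links H A C) (hdisj : ∀ C ∈ F, ∀ C' ∈ F, ∀ x ∈ C, x ∈ C' → C = C')
    (hF : A.card + 4 * k + 2 ≤ F.card) {α₁ α₂ y : V} (h₁ : α₁ ∈ A) (h₂ : α₂ ∈ A)
    (h₁₂ : α₁ = α₂ → A = {α₁}) {T₁ T₂ : List (V ⊕ Finset V)}
    (hT₁ : IsNodePath (incGraph H) (Sum.inl α₁ :: T₁))
    (hT₂ : IsNodePath (incGraph H) (Sum.inl α₂ :: T₂))
    (hA₁ : ∀ α ∈ A, Sum.inl α ∉ T₁) (hA₂ : ∀ α ∈ A, Sum.inl α ∉ T₂) (hT : T₁.Disjoint T₂)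
    (hlast : T₁.getLast? = some (Sum.inl y)) :
    T₁.length + T₂.length + 4 * A.card ≤ 2 * k + 3 := by
  obtain ⟨L, hLnd, hLlast, hLA, hLlen⟩ := exists_list_first_last h₁ h₂ h₁₂
  have hlen₁ := IsNodePath.length_le_of_inl hH hT₁
  have hlen₂ := IsNodePath.length_le_of_inl hH hT₂
  obtain ⟨P, hP⟩ : ∃ P : Finset (V ⊕ Finset V) → Prop, ∀ C, P C ↔ ∀ x ∈ T₁ ++ T₂, x ∉ C :=
    ⟨_, fun _ => Iff.rfl⟩
  set F' := F.filter P with hF'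
  have hF'card : L.length ≤ F'.card := by
    have h1 : (F.filter fun C => ¬ P C).card ≤ (T₁ ++ T₂).toFinset.card := by
      have hex : ∀ C ∈ F.filter fun C => ¬ P C, ∃ x ∈ T₁ ++ T₂, x ∈ C := by
        intro C hC
        have := (Finset.mem_filter.1 hC).2
        rw [hP] at this
        push Not at this
        exact this
      choose! f hf using hex
      refine Finset.card_le_card_of_injOn f ?_ ?_
      · intro C hC
        rw [Finset.mem_coe, List.mem_toFinset]
        exact (hf C hC).1
      · intro C hC C' hC' heq
        refine hdisj C (Finset.mem_filter.1 hC).1 C' (Finset.mem_filter.1 hC').1 (f C)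
          (hf C hC).2 ?_
        rw [heq]
        exact (hf C' hC').2
    have h2 := List.toFinset_card_le (T₁ ++ T₂)
    have h3 : F'.card + (F.filter fun C => ¬ P C).card = F.card :=
      Finset.card_filter_add_card_filter_not _
    rw [List.length_append] at h2
    omega
  obtain ⟨p, hp, hplast, hplen, hpmem⟩ := exists_path_through L α₁ α₂ F' hLnd hLlast hLA hF'card
    (fun C hC => hlinks C (Finset.mem_filter.1 hC).1)
    (fun C hC C' hC' => hdisj C (Finset.mem_filter.1 hC).1 C' (Finset.mem_filter.1 hC').1)
  have hpT : ∀ x ∈ p, x ∉ T₁ ∧ x ∉ T₂ := by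
    intro x hx
    rcases hpmem x hx with ⟨γ, hγ, rfl⟩ | ⟨C, hC, hxC⟩
    · exact ⟨hA₁ γ (hLA γ (by simp [hγ])), hA₂ γ (hLA γ (by simp [hγ]))⟩
    · have h := (hP C).1 (Finset.mem_filter.1 hC).2
      exact ⟨fun h' => h x (by simp [h']) hxC, fun h' => h x (by simp [h']) hxC⟩
  have hpath : IsNodePath (incGraph H) (T₁.reverse ++ (Sum.inl α₁ :: p ++ T₂)) := by
    constructor
    · rw [List.isChain_append, List.isChain_append]
      refine ⟨hT₁.tail.reverse.1, ⟨hp.1, hT₂.tail.1, ?_⟩, ?_⟩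
      · intro x hx y hy
        rw [hplast, Option.mem_some_iff] at hx
        subst hx
        exact (List.isChain_cons.1 hT₂.1).1 y hy
      · intro x hx y hy
        rw [List.getLast?_reverse] at hx
        simp only [List.cons_append, List.head?_cons, Option.mem_some_iff] at hy
        subst hy
        exact ((List.isChain_cons.1 hT₁.1).1 x hx).symm
    · rw [List.nodup_append', List.nodup_append']
      refine ⟨hT₁.tail.reverse.2, ⟨hp.2, hT₂.tail.2, ?_⟩, ?_⟩
      · intro x hx hx'
        rcases List.mem_cons.1 hx with rfl | hx
        · exact hA₂ α₁ h₁ hx'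
        · exact (hpT x hx).2 hx'
      · intro x hx hx'
        rw [List.mem_reverse] at hx
        rcases List.mem_append.1 hx' with hx' | hx'
        · rcases List.mem_cons.1 hx' with rfl | hx'
          · exact hA₁ α₁ h₁ hx
          · exact (hpT x hx').1 hx
        · exact hT hx hx'
  obtain ⟨l, hl⟩ : ∃ l, T₁.reverse ++ (Sum.inl α₁ :: p ++ T₂) = Sum.inl y :: l := by
    have h : T₁.reverse.head? = some (Sum.inl y) := by rw [List.head?_reverse, hlast]
    obtain ⟨t, ht⟩ := List.head?_eq_some_iff.1 h
    exact ⟨t ++ (Sum.inl α₁ :: p ++ T₂), by rw [ht]; rfl⟩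
  have hlen := congrArg List.length hl
  rw [hl] at hpath
  have := IsNodePath.length_le_of_inl hH hpath
  simp only [List.length_append, List.length_reverse, List.length_cons] at hlen
  omega

end Chaining

section Density

variable {V : Type*}

/-- Some vertex set induces a subhypergraph in which small sets meet many hyperedges. -/
theorem exists_dense_subset [Fintype V] (H : Finset (Finset V)) (D q : ℕ) :
    ∃ U : Finset V,
      (∀ S ⊆ U, S.card < q →
        D * S.card ≤ ((restrictTo H U).filter fun e => ∃ v ∈ S, v ∈ e).card) ∧
      (q : ℤ) * H.card - (q * D - 1) * Fintype.card V ≤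
        q * (restrictTo H U).card - (q * D - 1) * U.card := by
  obtain ⟨U, -, hU⟩ := Finset.exists_max_image (Finset.univ : Finset (Finset V))
    (fun U => (q : ℤ) * (restrictTo H U).card - (q * D - 1) * U.card) ⟨∅, by simp⟩
  refine ⟨U, fun S hS hSq => ?_, ?_⟩
  · have h1 := hU (U \ S) (Finset.mem_univ _)
    have h2 : (restrictTo H U).card ≤ (restrictTo H (U \ S)).card +
        ((restrictTo H U).filter fun e => ∃ v ∈ S, v ∈ e).card := by
      refine (Finset.card_le_card ?_).trans (Finset.card_union_le _ _)
      intro e he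
      simp only [restrictTo, Finset.mem_union, Finset.mem_filter] at he ⊢
      by_cases hS : ∃ v ∈ S, v ∈ e
      · exact Or.inr ⟨he, hS⟩
      · exact Or.inl ⟨he.1, fun v hv => Finset.mem_sdiff.2 ⟨he.2 hv, fun h => hS ⟨v, h, hv⟩⟩⟩
    have h3 := Finset.card_sdiff_add_card_eq_card hS
    have h3' : ((U \ S).card : ℤ) = U.card - S.card := by
      rw [← h3]; push_cast; ring
    rw [h3'] at h1
    have h2' : ((restrictTo H U).card : ℤ) ≤ (restrictTo H (U \ S)).card +
        ((restrictTo H U).filter fun e => ∃ v ∈ S, v ∈ e).card := by exact_mod_cast h2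
    by_contra! hlt
    have hlt' : (((restrictTo H U).filter fun e => ∃ v ∈ S, v ∈ e).card : ℤ) + 1 ≤
      D * S.card := by exact_mod_cast hlt
    have hq : (S.card : ℤ) + 1 ≤ q := by exact_mod_cast hSq
    have hq0 : (0 : ℤ) ≤ q := by positivity
    nlinarith [mul_le_mul_of_nonneg_left h2' hq0, mul_le_mul_of_nonneg_left hlt' hq0]
  · have h := hU Finset.univ (Finset.mem_univ _)
    have hH : restrictTo H Finset.univ = H := by
      simp [restrictTo]
    simp only [hH, Finset.card_univ] at h
    exact h

/-- A connected piece of the incidence graph attached to the rest only at vertices, the set `A`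
being a maximal set of attachment vertices pairwise lying on two distinct hyperedges. -/
structure IsCopy (H : Finset (Finset V)) (D : ℕ) (A : Finset V) (C : Finset (V ⊕ Finset V)) :
    Prop where
  nonempty : C.toLeft.Nonempty
  mem : ∀ e ∈ C.toRight, e ∈ H
  meets : ∀ e ∈ C.toRight, ∃ v ∈ C.toLeft, v ∈ e
  conn : PathConnected (incGraph H) C
  dense : D * C.toLeft.card ≤ C.toRight.card
  notMem : ∀ α ∈ A, Sum.inl α ∉ C
  attach : ∀ α ∈ A, ∃ e ∈ C.toRight, α ∈ e
  linked : ∀ α ∈ A, ∀ β ∈ A, α ≠ β →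
    ∃ e ∈ C.toRight, ∃ e' ∈ C.toRight, e ≠ e' ∧ α ∈ e ∧ β ∈ e'
  weak : ∀ e ∈ C.toRight,
    ¬ e ⊆ C.toLeft ∪ A.filter (fun α =>
      ∃ e ∈ C.toRight, ∃ e' ∈ C.toRight, e ≠ e' ∧ α ∈ e ∧ α ∈ e') →
    ∃ γ ∈ A, γ ∈ e ∧ ∀ e' ∈ C.toRight, γ ∈ e' → e' = e

theorem exists_linked_attachments {K N : Finset V} {E : Finset (Finset V)}
    (hEN : ∀ e ∈ E, e ⊆ K ∪ N) (hN : ∀ α ∈ N, ∃ e ∈ E, α ∈ e) :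
    ∃ A ⊆ N, (∀ α ∈ A, ∀ β ∈ A, α ≠ β → ∃ e ∈ E, ∃ e' ∈ E, e ≠ e' ∧ α ∈ e ∧ β ∈ e') ∧
      ∀ e ∈ E, ¬ e ⊆ K ∪ A.filter (fun α => ∃ e ∈ E, ∃ e' ∈ E, e ≠ e' ∧ α ∈ e ∧ α ∈ e') →
        ∃ γ ∈ A, γ ∈ e ∧ ∀ e' ∈ E, γ ∈ e' → e' = e := by
  obtain ⟨P, hP⟩ : ∃ P : Finset V → Prop, ∀ A, P A ↔
      ∀ α ∈ A, ∀ β ∈ A, α ≠ β → ∃ e ∈ E, ∃ e' ∈ E, e ≠ e' ∧ α ∈ e ∧ β ∈ e' :=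
    ⟨_, fun _ => Iff.rfl⟩
  obtain ⟨A, hA, hmax⟩ := Finset.exists_max_image (N.powerset.filter P) Finset.card
    ⟨∅, by simp [hP]⟩
  simp only [Finset.mem_filter, Finset.mem_powerset] at hA hmax
  refine ⟨A, hA.1, (hP A).1 hA.2, fun e he hsub => ?_⟩
  obtain ⟨β, hβe, hβ⟩ := Finset.not_subset.1 hsub
  simp only [Finset.mem_union, Finset.mem_filter, not_or, not_and, not_exists] at hβ
  have hβN : β ∈ N := (Finset.mem_union.1 (hEN e he hβe)).resolve_left hβ.1
  by_cases hβA : β ∈ A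
  · refine ⟨β, hβA, hβe, fun e' he' hβe' => ?_⟩
    by_contra hne
    exact hβ.2 hβA e' he' e he hne hβe' hβe
  · have hins : ¬ P (insert β A) := by
      intro h
      have := hmax (insert β A) ⟨Finset.insert_subset hβN hA.1, h⟩
      rw [Finset.card_insert_of_notMem hβA] at this
      omega
    obtain ⟨γ, hγA, hγ⟩ : ∃ γ ∈ A, ∀ e' ∈ E, γ ∈ e' → e' = e := by
      by_contra! hno
      refine hins ((hP _).2 fun α₁ h₁ α₂ h₂ hne => ?_)
      rw [Finset.mem_insert] at h₁ h₂
      rcases h₁ with rfl | h₁ <;> rcases h₂ with rfl | h₂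
      · exact absurd rfl hne
      · obtain ⟨e', he', hαe', hne'⟩ := hno α₂ h₂
        exact ⟨e, he, e', he', hne'.symm, hβe, hαe'⟩
      · obtain ⟨e', he', hαe', hne'⟩ := hno α₁ h₁
        exact ⟨e', he', e, he, hne', hαe', hβe⟩
      · exact (hP A).1 hA.2 α₁ h₁ α₂ h₂ hne
    obtain ⟨e₁, he₁, hγe₁⟩ := hN γ (hA.1 hγA)
    exact ⟨γ, hγA, hγ e₁ he₁ hγe₁ ▸ hγe₁, hγ⟩

theorem PathConnected.mono {W : Type*} {G G' : SimpleGraph W} (h : G ≤ G') {C : Finset W}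
    (hC : PathConnected G C) : PathConnected G' C := by
  intro u hu v hv
  obtain ⟨l, hl, h1⟩ := hC u hu v hv
  exact ⟨l, hl.mono h, h1⟩

/-- Number of parts needed in order to find `M` copies. -/
def partsNeeded (r k M : ℕ) : ℕ :=
  2 ^ (2 * k + 1) * (r + 1 + 2 ^ (2 * k + 1) + 2 ^ (2 * k + 1) * M)

theorem exists_copies [Fintype V] {r k D M a : ℕ} {H : Finset (Finset V)}
    (hunif : ∀ e ∈ H, e.card = r) (hr : 0 < r) (hH : IsEmpty (BergePath H k)) (hD : 0 < D)
    (hcard : D * Fintype.card V ≤ H.card + D * a)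
    (hbig : (partBound (partsNeeded r k M) (2 * k + 2) + 1) *
      (D * a + partBound (partsNeeded r k M) (2 * k + 2) + 1) ≤ Fintype.card V) :
    ∃ (A : Finset V) (F : Finset (Finset (V ⊕ Finset V))), A.card ≤ 2 * k + 1 ∧ M ≤ F.card ∧
      (∀ C ∈ F, IsCopy H D A C) ∧ ∀ C ∈ F, ∀ C' ∈ F, ∀ x ∈ C, x ∈ C' → C = C' := by
  set R := partBound (partsNeeded r k M) (2 * k + 2) with hR
  obtain ⟨U, hdense, hUcard⟩ := exists_dense_subset H D (R + 1)
  set HU := restrictTo H U with hHU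
  have hHUmem : ∀ e, e ∈ HU ↔ e ∈ H ∧ e ⊆ U := by
    intro e; rw [hHU, restrictTo, Finset.mem_filter]
  have hle : incGraph HU ≤ incGraph H := incGraph_mono fun e he => ((hHUmem e).1 he).1
  have hUbig : R < HU.card := by
    by_contra! hcon
    have h1 : ((R : ℤ) + 1) * (D * a + R + 1) ≤ Fintype.card V := by exact_mod_cast hbig
    have h2 : (D : ℤ) * Fintype.card V ≤ H.card + D * a := by exact_mod_cast hcard
    have h3 : (HU.card : ℤ) ≤ R := by exact_mod_cast hcon
    have hR0 : (0 : ℤ) ≤ R := by positivity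
    have hD1 : (1 : ℤ) ≤ D := by exact_mod_cast hD
    have hU0 : (0 : ℤ) ≤ U.card := by positivity
    push_cast at hUcard
    have h4 : (0 : ℤ) ≤ ((R + 1) * D - 1) * U.card := by
      apply mul_nonneg _ hU0
      nlinarith
    nlinarith [mul_le_mul_of_nonneg_left h2 (by linarith : (0 : ℤ) ≤ R + 1),
      mul_le_mul_of_nonneg_left h3 (by linarith : (0 : ℤ) ≤ R + 1)]
  obtain ⟨Z, hZ, F₀, hF₀, hparts⟩ := exists_many_parts (G := incGraph HU) (partsNeeded r k M)
    (2 * k + 1) (U.disjSum HU) (by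
      rintro (v | e) hu (w | f) hadj
      · exact hadj.elim
      · exact Finset.inr_mem_disjSum.2 hadj.1
      · exact Finset.inl_mem_disjSum.2 (((hHUmem e).1 hadj.1).2 hadj.2)
      · exact hadj.elim)
    (fun l hl _ => (hl.mono hle).length_le hH)
    (by
      rw [Finset.card_disjSum]
      exact hUbig.trans_le (Nat.le_add_left _ _))
  have hZpow : Z.powerset.card ≤ 2 ^ (2 * k + 1) := by
    rw [Finset.card_powerset]
    exact Nat.pow_le_pow_right (by norm_num) hZ
  obtain ⟨N, -, hN⟩ := Finset.exists_le_card_fiber_of_mul_le_card_of_maps_to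
    (s := F₀) (t := Z.powerset) (n := r + 1 + 2 ^ (2 * k + 1) + 2 ^ (2 * k + 1) * M)
    (f := fun C => Z.filter fun z => ∃ x ∈ C, (incGraph HU).Adj x z)
    (fun C _ => by simp) ⟨∅, by simp⟩ ((Nat.mul_le_mul_right _ hZpow).trans hF₀)
  set F₁ := F₀.filter fun C => (Z.filter fun z => ∃ x ∈ C, (incGraph HU).Adj x z) = N with hF₁
  have hF₁mem : ∀ C ∈ F₁, C ⊆ U.disjSum HU ∧ C.card ≤ R ∧ IsPart (incGraph HU) Z C ∧
      ∀ z, z ∈ N ↔ z ∈ Z ∧ ∃ x ∈ C, (incGraph HU).Adj x z := by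
    intro C hC
    obtain ⟨hC₀, hCN⟩ := Finset.mem_filter.1 hC
    obtain ⟨h1, h2, h3⟩ := hparts C hC₀
    refine ⟨h1, h2, h3, fun z => ?_⟩
    rw [← hCN, Finset.mem_filter]
  have hdisj : ∀ C ∈ F₁, ∀ C' ∈ F₁, ∀ x ∈ C, x ∈ C' → C = C' := fun C hC C' hC' x hx hx' =>
    (hF₁mem C hC).2.2.1.eq_of_mem (hF₁mem C' hC').2.2.1 hx hx'
  have hNedge : ∀ e, Sum.inr e ∉ N := by
    intro e heN
    have hex : ∀ C ∈ F₁, ∃ v, v ∈ e ∧ Sum.inl v ∈ C ∧ e ∈ HU := by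
      intro C hC
      obtain ⟨-, v | f, hx, hadj⟩ := ((hF₁mem C hC).2.2.2 _).1 heN
      · exact ⟨v, hadj.2, hx, hadj.1⟩
      · exact hadj.elim
    obtain ⟨C₁, hC₁⟩ : F₁.Nonempty := Finset.card_pos.1 (by omega)
    have : Nonempty V := ⟨(hex C₁ hC₁).choose⟩
    choose! f hf using hex
    have hle : F₁.card ≤ e.card := by
      refine Finset.card_le_card_of_injOn f (fun C hC => (hf C hC).1) ?_
      intro C hC C' hC' heq
      exact hdisj C hC C' hC' _ (hf C hC).2.1 (heq ▸ (hf C' hC').2.1)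
    rw [hunif e ((hHUmem e).1 (hf C₁ hC₁).2.2).1] at hle
    omega
  have hNcard : N.toLeft.card ≤ 2 * k + 1 := by
    have hNZ : N ⊆ Z := by
      obtain ⟨C₁, hC₁⟩ : F₁.Nonempty := Finset.card_pos.1 (by omega)
      exact fun z hz => (((hF₁mem C₁ hC₁).2.2.2 z).1 hz).1
    exact Finset.card_toLeft_le.trans ((Finset.card_le_card hNZ).trans hZ)
  have hNpow : N.toLeft.powerset.card ≤ 2 ^ (2 * k + 1) := by
    rw [Finset.card_powerset]
    exact Nat.pow_le_pow_right (by norm_num) hNcard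
  set F₂ := F₁.filter fun C => C.toLeft.Nonempty with hF₂
  have hF₂card : 2 ^ (2 * k + 1) * M ≤ F₂.card := by
    have hpure : (F₁.filter fun C => ¬ C.toLeft.Nonempty).card ≤ 2 ^ (2 * k + 1) := by
      refine le_trans ?_ hNpow
      have hex : ∀ C ∈ F₁.filter fun C => ¬ C.toLeft.Nonempty,
          ∃ e, Sum.inr e ∈ C ∧ e ⊆ N.toLeft := by
        intro C hC
        obtain ⟨hC₁, hCempty⟩ := Finset.mem_filter.1 hC
        obtain ⟨hCS, -, hCpart, hCN⟩ := hF₁mem C hC₁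
        rw [Finset.not_nonempty_iff_eq_empty] at hCempty
        obtain ⟨v | e, hx⟩ := hCpart.nonempty
        · exact absurd (Finset.mem_toLeft.2 hx) (by simp [hCempty])
        refine ⟨e, hx, fun v hv => ?_⟩
        have heHU : e ∈ HU := Finset.inr_mem_disjSum.1 (hCS hx)
        have hadj : (incGraph HU).Adj (Sum.inr e) (Sum.inl v) := ⟨heHU, hv⟩
        rw [Finset.mem_toLeft, hCN]
        refine ⟨(hCpart.closed _ hx _ hadj).resolve_left fun h => ?_, _, hx, hadj⟩
        exact absurd (Finset.mem_toLeft.2 h) (by simp [hCempty])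
      choose! f hf using hex
      refine Finset.card_le_card_of_injOn f (fun C hC => ?_) ?_
      · rw [Finset.mem_coe, Finset.mem_powerset]
        exact (hf C hC).2
      · intro C hC C' hC' heq
        exact hdisj C (Finset.mem_filter.1 hC).1 C' (Finset.mem_filter.1 hC').1 _ (hf C hC).1
          (heq ▸ (hf C' hC').1)
    have hsum : F₂.card + (F₁.filter fun C => ¬ C.toLeft.Nonempty).card = F₁.card :=
      Finset.card_filter_add_card_filter_not _
    omega
  have hcopy : ∀ C ∈ F₂, ∃ A ⊆ N.toLeft, IsCopy H D A C := by
    intro C hC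
    obtain ⟨hC₁, hCne⟩ := Finset.mem_filter.1 hC
    obtain ⟨hCS, hCcard, hCpart, hCN⟩ := hF₁mem C hC₁
    have hright : ∀ e ∈ C.toRight, e ∈ HU := fun e he =>
      Finset.inr_mem_disjSum.1 (hCS (Finset.mem_toRight.1 he))
    have hEN : ∀ e ∈ C.toRight, e ⊆ C.toLeft ∪ N.toLeft := by
      intro e he v hv
      have hadj : (incGraph HU).Adj (Sum.inr e) (Sum.inl v) := ⟨hright e he, hv⟩
      rw [Finset.mem_union, Finset.mem_toLeft, Finset.mem_toLeft, hCN]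
      refine (hCpart.closed _ (Finset.mem_toRight.1 he) _ hadj).imp_right fun h => ?_
      exact ⟨h, _, Finset.mem_toRight.1 he, hadj⟩
    have hattach : ∀ α ∈ N.toLeft, ∃ e ∈ C.toRight, α ∈ e := by
      intro α hα
      obtain ⟨-, v | e, hx, hadj⟩ := (hCN _).1 (Finset.mem_toLeft.1 hα)
      · exact hadj.elim
      · exact ⟨e, Finset.mem_toRight.2 hx, hadj.2⟩
    obtain ⟨A, hAN, hlinked, hweak⟩ := exists_linked_attachments hEN hattach
    refine ⟨A, hAN, hCne, fun e he => ((hHUmem e).1 (hright e he)).1, ?_,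
      hCpart.conn.mono hle, ?_, ?_, fun α hα => hattach α (hAN hα), hlinked, hweak⟩
    · intro e he
      obtain ⟨v, hv⟩ := hCne
      obtain ⟨l, hl, hhd, hlast, hlC⟩ := hCpart.conn _ (Finset.mem_toRight.1 he) _
        (Finset.mem_toLeft.1 hv)
      rcases l with _ | ⟨b, _ | ⟨w, l⟩⟩
      · simp at hhd
      · simp only [List.head?_cons, List.getLast?_singleton, Option.some.injEq] at hhd hlast
        rw [hhd] at hlast
        cases hlast
      · obtain rfl : b = Sum.inr e := by simpa using hhd
        have hadj := (List.isChain_cons_cons.1 hl.1).1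
        rcases w with w | f
        · exact ⟨w, Finset.mem_toLeft.2 (hlC _ (by simp)), hadj.2⟩
        · exact hadj.elim
    · have hKU : C.toLeft ⊆ U := fun v hv =>
        Finset.inl_mem_disjSum.1 (hCS (Finset.mem_toLeft.1 hv))
      refine (hdense C.toLeft hKU ?_).trans (Finset.card_le_card ?_)
      · have := Finset.card_toLeft_le (u := C)
        omega
      · intro e he
        obtain ⟨heHU, v, hvC, hve⟩ := Finset.mem_filter.1 he
        have hadj : (incGraph HU).Adj (Sum.inl v) (Sum.inr e) := ⟨heHU, hve⟩
        rw [Finset.mem_toRight]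
        refine (hCpart.closed _ (Finset.mem_toLeft.1 hvC) _ hadj).resolve_right fun h => ?_
        exact hNedge e ((hCN _).2 ⟨h, _, Finset.mem_toLeft.1 hvC, hadj⟩)
    · intro α hα hαC
      exact hCpart.notMem _ hαC (((hCN _).1 (Finset.mem_toLeft.1 (hAN hα))).1)
  choose! A hAN hA using hcopy
  obtain ⟨A₀, hA₀N, hA₀⟩ := Finset.exists_le_card_fiber_of_mul_le_card_of_maps_to
    (s := F₂) (t := N.toLeft.powerset) (n := M) (f := A)
    (fun C hC => Finset.mem_powerset.2 (hAN C hC)) ⟨∅, by simp⟩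
    ((Nat.mul_le_mul_right _ hNpow).trans hF₂card)
  refine ⟨A₀, _, (Finset.card_le_card (Finset.mem_powerset.1 hA₀N)).trans hNcard, hA₀, fun C hC => ?_, fun C hC C' hC' => ?_⟩
  · rw [Finset.mem_filter] at hC
    exact hC.2 ▸ hA C hC.1
  · exact hdisj C (Finset.mem_filter.1 (Finset.mem_filter.1 hC).1).1 C'
      (Finset.mem_filter.1 (Finset.mem_filter.1 hC').1).1

end Density

section Copies

variable {V : Type*}

theorem le_choose_pred {r a : ℕ} (hr : 3 ≤ r) (ha : 2 * r ≤ a + 1) :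
    a - 1 ≤ (a - 1).choose (r - 2) := by
  rcases Nat.lt_or_ge 3 r with h | h
  · exact (Nat.sub_le a 1).trans (le_choose_of_two_mul_le h ha)
  · obtain rfl : r = 3 := by omega
    simp

theorem choose_eq_pred {r a : ℕ} (hr : 3 ≤ r) (ha : 2 * r ≤ a + 1) :
    a.choose (r - 1) = (a - 1).choose (r - 2) + (a - 1).choose (r - 1) := by
  obtain ⟨b, rfl⟩ : ∃ b, a = b + 1 := ⟨a - 1, by omega⟩
  obtain ⟨t, rfl⟩ : ∃ t, r = t + 2 := ⟨r - 2, by omega⟩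
  simp [Nat.choose_succ_succ]

theorem choose_add_lt {r a x w : ℕ} (hr : 3 ≤ r) (ha : 2 * r ≤ a + 1) (hxw : x + w < a) :
    x.choose (r - 1) + w < a.choose (r - 1) := by
  have h1 := choose_eq_pred hr ha
  have h2 := le_choose_pred hr ha
  rcases Nat.eq_zero_or_pos x with rfl | hx
  · have h3 : 0 < (a - 1).choose (r - 1) := Nat.choose_pos (by omega)
    rw [Nat.choose_eq_zero_of_lt (by omega : 0 < r - 1)]
    omega
  · have h3 : x.choose (r - 1) ≤ (a - 1).choose (r - 1) := Nat.choose_le_choose _ (by omega)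
    omega

/-- Node paths inside `C` only use the hyperedges of `C`. -/
theorem IsNodePath.incGraph_of_forall_mem {H E : Finset (Finset V)} {l : List (V ⊕ Finset V)}
    (hl : IsNodePath (incGraph H) l) (hE : ∀ e, Sum.inr e ∈ l → e ∈ E) :
    IsNodePath (incGraph E) l := by
  refine ⟨?_, hl.2⟩
  have h := hl.1
  rw [List.isChain_iff_getElem] at h ⊢
  intro i hi
  have hadj := h i hi
  have h1 := List.getElem_mem (l := l) (n := i) (by omega)
  have h2 := List.getElem_mem (l := l) (n := i + 1) hi
  generalize l[i] = x at *
  generalize l[i + 1] = y at *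
  rcases x with v | e <;> rcases y with w | f
  · exact hadj.elim
  · exact ⟨hE f h2, hadj.2⟩
  · exact ⟨hE e h1, hadj.2⟩
  · exact hadj.elim

theorem IsTail.edge_mem {E : Finset (Finset V)} {α : V} {K : Finset V}
    {l : List (V ⊕ Finset V)} (hl : IsTail E α K l) {e : Finset V} (he : Sum.inr e ∈ l) :
    e ∈ E := by
  obtain ⟨l₁, l₂, rfl⟩ := List.append_of_mem he
  have hch := hl.1.1
  obtain ⟨p, hp, -⟩ := hl.exists_pred
  rw [← List.cons_append, List.isChain_append] at hch
  exact (hch.2.2 _ hp (Sum.inr e) (by simp)).1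

variable {H : Finset (Finset V)} {D : ℕ} {A : Finset V} {C : Finset (V ⊕ Finset V)}

theorem IsCopy.links (hC : IsCopy H D A C) : Links H A C := by
  refine ⟨hC.notMem, fun α hα β hβ hαβ => ?_⟩
  obtain ⟨e, he, e', he', hne, hαe, hβe'⟩ := hC.linked α hα β hβ hαβ
  obtain ⟨l, hl, hhd, hlast, hlC⟩ := hC.conn _ (Finset.mem_toRight.1 he) _
    (Finset.mem_toRight.1 he')
  refine ⟨l, ?_, hl.2, hlC, ?_⟩
  · rcases l with _ | ⟨b, _ | ⟨c, _ | ⟨d, l⟩⟩⟩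
    · simp at hhd
    · simp only [List.head?_cons, List.getLast?_singleton, Option.some.injEq] at hhd hlast
      rw [hhd] at hlast
      exact absurd (Sum.inr.inj hlast) hne
    · simp only [List.head?_cons, List.getLast?_cons_cons, List.getLast?_singleton,
        Option.some.injEq] at hhd hlast
      subst hhd; subst hlast
      exact (List.isChain_cons_cons.1 hl.1).1.elim
    · simp
  · rw [List.isChain_cons, List.isChain_append]
    refine ⟨?_, hl.1, by simp, ?_⟩
    · intro x hx
      rw [List.head?_append, hhd, Option.some_or, Option.mem_some_iff] at hx
      subst hx
      exact ⟨hC.mem e he, hαe⟩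
    · intro x hx y hy
      rw [hlast, Option.mem_some_iff] at hx
      simp only [List.head?_cons, Option.mem_some_iff] at hy
      subst hx; subst hy
      exact ⟨hC.mem e' he', hβe'⟩

theorem IsCopy.exists_short_tail (hC : IsCopy H D A C) {α : V} (hα : α ∈ A) :
    ∃ T, IsNodePath (incGraph H) (Sum.inl α :: T) ∧ (∀ x ∈ T, x ∈ C) ∧
      (∃ y, T.getLast? = some (Sum.inl y)) ∧ T.length = 2 := by
  obtain ⟨e, he, hαe⟩ := hC.attach α hα
  obtain ⟨v, hv, hve⟩ := hC.meets e he
  have hvC := Finset.mem_toLeft.1 hv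
  refine ⟨[Sum.inr e, Sum.inl v], ⟨?_, ?_⟩, ?_, ⟨v, rfl⟩, rfl⟩
  · simp [hC.mem e he, hαe, hve]
  · have : α ≠ v := by
      rintro rfl
      exact hC.notMem α hα hvC
    simp [this]
  · simp [hvC, Finset.mem_toRight.1 he]

theorem IsCopy.exists_tail_mem (hC : IsCopy H D A C) {α y : V} (hα : α ∈ A)
    (hy : y ∈ C.toLeft) :
    ∃ l, IsTail C.toRight α C.toLeft l ∧ l.getLast? = some (Sum.inl y) := by
  obtain ⟨e, he, hαe⟩ := hC.attach α hα
  obtain ⟨l, hl, hhd, hlast, hlC⟩ := hC.conn _ (Finset.mem_toRight.1 he) _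
    (Finset.mem_toLeft.1 hy)
  refine ⟨l, ⟨?_, fun w hw => Finset.mem_toLeft.2 (hlC _ hw)⟩, hlast⟩
  refine IsNodePath.incGraph_of_forall_mem (H := H) ⟨?_, ?_⟩ ?_
  · rw [List.isChain_cons]
    refine ⟨fun x hx => ?_, hl.1⟩
    rw [hhd, Option.mem_some_iff] at hx
    subst hx
    exact ⟨hC.mem e he, hαe⟩
  · exact List.nodup_cons.2 ⟨fun h => hC.notMem α hα (hlC _ h), hl.2⟩
  · intro f hf
    refine Finset.mem_toRight.2 (hlC _ ?_)
    simpa using hf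

theorem IsCopy.exists_long_tail {r a : ℕ} (hr : 3 ≤ r) (ha : 2 * r ≤ a + 1)
    (hunif : ∀ e ∈ H, e.card = r) (hC : IsCopy H (a.choose (r - 1)) A C) (hA : A.card < a)
    {α : V} (hα : α ∈ A) :
    ∃ T, IsNodePath (incGraph H) (Sum.inl α :: T) ∧ (∀ x ∈ T, x ∈ C) ∧
      (∃ y, T.getLast? = some (Sum.inl y)) ∧ 2 * (a - A.card) + 4 ≤ T.length := by
  set X := A.filter (fun α =>
      ∃ e ∈ C.toRight, ∃ e' ∈ C.toRight, e ≠ e' ∧ α ∈ e ∧ α ∈ e') with hX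
  have hXA : X ⊆ A := Finset.filter_subset _ _
  have hunif' : ∀ e ∈ C.toRight, e.card = r := fun e he => hunif e (hC.mem e he)
  have hXw := Finset.card_sdiff_add_card_eq_card hXA
  have hfew : (C.toRight.filter fun e => ¬ e ⊆ C.toLeft ∪ X).card ≤ (A \ X).card := by
    have hex : ∀ e ∈ C.toRight.filter fun e => ¬ e ⊆ C.toLeft ∪ X,
        ∃ γ, γ ∈ A ∧ γ ∈ e ∧ ∀ e' ∈ C.toRight, γ ∈ e' → e' = e := by
      intro e he
      obtain ⟨he, hsub⟩ := Finset.mem_filter.1 he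
      exact hC.weak e he hsub
    have : Nonempty V := ⟨α⟩
    choose! f hf using hex
    refine Finset.card_le_card_of_injOn f (fun e he => ?_) ?_
    · rw [Finset.mem_coe, Finset.mem_sdiff]
      refine ⟨(hf e he).1, fun h => ?_⟩
      obtain ⟨-, e₁, he₁, e₂, he₂, hne, h₁, h₂⟩ := Finset.mem_filter.1 h
      exact hne (((hf e he).2.2 e₁ he₁ h₁).trans ((hf e he).2.2 e₂ he₂ h₂).symm)
    · intro e he e' he' heq
      have h := (hf e he).2.1
      rw [heq] at h
      exact (hf e' he').2.2 e (Finset.mem_filter.1 he).1 h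
  have hmeet : edgesMeeting C.toRight X C.toLeft =
      C.toRight.filter fun e => e ⊆ C.toLeft ∪ X := by
    refine Finset.filter_congr fun e he => ?_
    exact and_iff_left (hC.meets e he)
  have hsum : (C.toRight.filter fun e => e ⊆ C.toLeft ∪ X).card +
      (C.toRight.filter fun e => ¬ e ⊆ C.toLeft ∪ X).card = C.toRight.card :=
    Finset.card_filter_add_card_filter_not _
  have hdense := hC.dense
  have hchoose := choose_add_lt (x := X.card) (w := (A \ X).card) hr ha (by omega)
  obtain ⟨T, hTK, hTne, -, hTdeg⟩ := exists_core (E := C.toRight) (K := C.toLeft) (X := X)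
    (D := a.choose (r - 1)) (c := -((A \ X).card : ℤ)) hunif' hC.nonempty
    (by
      rw [hmeet]
      have : a.choose (r - 1) * C.toLeft.card ≤
        (C.toRight.filter fun e => e ⊆ C.toLeft ∪ X).card + (A \ X).card := by omega
      have h : ((a.choose (r - 1) * C.toLeft.card : ℕ) : ℤ) ≤
        ((C.toRight.filter fun e => e ⊆ C.toLeft ∪ X).card + (A \ X).card : ℕ) := by
        exact_mod_cast this
      push_cast at h
      linarith)
    (by omega)
  obtain ⟨y, hy⟩ := hTne
  obtain ⟨l₀, hl₀, hl₀last⟩ := hC.exists_tail_mem hα (hTK hy)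
  obtain ⟨l, hl, ⟨z, -, hlast⟩, hlen⟩ := _root_.exists_long_tail hr ha hunif' (K := C.toLeft)
    (fun h => hC.notMem α hα (Finset.mem_toLeft.1 h)) (by omega) hTK hTdeg
    ⟨l₀, hl₀, y, hy, hl₀last⟩
  refine ⟨l, hl.1.mono (incGraph_mono hC.mem), ?_, ⟨z, hlast⟩, by omega⟩
  rintro (w | e) hx
  · exact Finset.mem_toLeft.1 (hl.2 w hx)
  · exact Finset.mem_toRight.1 (hl.edge_mem hx)

/-- Copies attached somewhere are attached at exactly `a` vertices. -/
theorem card_eq_of_copies {r k a : ℕ} (hr : 3 ≤ r) (ha : 2 * r ≤ a + 1) (hk : k ≤ 2 * a + 2)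
    (hunif : ∀ e ∈ H, e.card = r) (hH : IsEmpty (BergePath H k))
    {F : Finset (Finset (V ⊕ Finset V))} (hF : A.card + 4 * k + 2 ≤ F.card)
    (hcopy : ∀ C ∈ F, IsCopy H (a.choose (r - 1)) A C)
    (hdisj : ∀ C ∈ F, ∀ C' ∈ F, ∀ x ∈ C, x ∈ C' → C = C') (hA : A.Nonempty) : A.card = a := by
  obtain ⟨C₁, hC₁, C₂, hC₂, hne⟩ := Finset.one_lt_card.1 (by omega : 1 < F.card)
  obtain ⟨α₁, h₁, α₂, h₂, h₁₂⟩ : ∃ α₁ ∈ A, ∃ α₂ ∈ A, α₁ = α₂ → A = {α₁} := by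
    obtain ⟨α, hα⟩ := hA
    by_cases hs : A = {α}
    · exact ⟨α, hα, α, hα, fun _ => hs⟩
    · obtain ⟨β, hβ, hβα⟩ : ∃ β ∈ A, β ≠ α := by
        by_contra! h
        exact hs (Finset.eq_singleton_iff_unique_mem.2 ⟨hα, h⟩)
      exact ⟨α, hα, β, hβ, fun h => absurd h.symm hβα⟩
  have hjoin : ∀ T₁ T₂ : List (V ⊕ Finset V), IsNodePath (incGraph H) (Sum.inl α₁ :: T₁) →
      IsNodePath (incGraph H) (Sum.inl α₂ :: T₂) → (∀ x ∈ T₁, x ∈ C₁) → (∀ x ∈ T₂, x ∈ C₂) →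
      (∃ y, T₁.getLast? = some (Sum.inl y)) →
      T₁.length + T₂.length + 4 * A.card ≤ 2 * k + 3 := by
    rintro T₁ T₂ hT₁ hT₂ hT₁C hT₂C ⟨y, hy⟩
    refine length_add_length_le_of_links hH (fun C hC => (hcopy C hC).links) hdisj hF h₁ h₂ h₁₂
      hT₁ hT₂ (fun α hα h => (hcopy C₁ hC₁).notMem α hα (hT₁C _ h))
      (fun α hα h => (hcopy C₂ hC₂).notMem α hα (hT₂C _ h)) ?_ hy
    exact fun x hx hx' => hne (hdisj C₁ hC₁ C₂ hC₂ x (hT₁C x hx) (hT₂C x hx'))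
  rcases lt_trichotomy A.card a with hlt | heq | hgt
  · obtain ⟨T₁, hT₁, hT₁C, hy, hlen₁⟩ := (hcopy C₁ hC₁).exists_long_tail hr ha hunif hlt h₁
    obtain ⟨T₂, hT₂, hT₂C, -, hlen₂⟩ := (hcopy C₂ hC₂).exists_long_tail hr ha hunif hlt h₂
    have := hjoin T₁ T₂ hT₁ hT₂ hT₁C hT₂C hy
    omega
  · exact heq
  · obtain ⟨T₁, hT₁, hT₁C, hy, hlen₁⟩ := (hcopy C₁ hC₁).exists_short_tail h₁
    obtain ⟨T₂, hT₂, hT₂C, -, hlen₂⟩ := (hcopy C₂ hC₂).exists_short_tail h₂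
    have := hjoin T₁ T₂ hT₁ hT₂ hT₁C hT₂C hy
    omega

end Copies

section Connected

variable {V : Type*}

theorem IsTail.exists_mem_edge {E : Finset (Finset V)} {α y : V} {K : Finset V}
    {l : List (V ⊕ Finset V)} (hl : IsTail E α K l) (hy : l.getLast? = some (Sum.inl y))
    {e : Finset V} (he : Sum.inr e ∈ l) : ∃ w ∈ K, w ∈ e := by
  obtain ⟨l₁, l₂, rfl⟩ := List.append_of_mem he
  rcases l₂ with _ | ⟨w | f, l₂⟩
  · simp at hy
  · refine ⟨w, hl.2 w (by simp), ?_⟩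
    have hch := hl.1.1
    rw [← List.cons_append, List.isChain_append, List.isChain_cons_cons] at hch
    exact hch.2.1.1.2
  · have hch := hl.1.1
    rw [← List.cons_append, List.isChain_append, List.isChain_cons_cons] at hch
    exact hch.2.1.1.elim

/-- A connected hypergraph contains a path from a given set `S` to a vertex outside it whose
inner vertices avoid `S`. -/
theorem HConnected.exists_tail [Fintype V] {H : Finset (Finset V)} (hH : HConnected H)
    {S : Finset V} (hS : S.Nonempty) {y : V} (hy : y ∉ S) :
    ∃ α ∈ S, ∃ l, IsTail (H.filter fun e => ¬ e ⊆ S) α (Finset.univ \ S) l ∧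
      l.getLast? = some (Sum.inl y) := by
  have hex : ∃ n, ∃ s ∈ S, ∃ l, IsNodePath (incGraph H) (Sum.inl s :: l) ∧
      (Sum.inl s :: l).getLast? = some (Sum.inl y) ∧ l.length = n := by
    obtain ⟨s, hs⟩ := hS
    obtain ⟨l, hl, hhd, hlast⟩ := hH.exists_isNodePath s y
    rcases l with _ | ⟨b, l⟩
    · simp at hhd
    · obtain rfl : b = Sum.inl s := by simpa using hhd
      exact ⟨_, s, hs, l, hl, hlast, rfl⟩
  obtain ⟨α, hα, l, hl, hlast, hlen⟩ := Nat.find_spec hex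
  have hlast' : l.getLast? = some (Sum.inl y) := by
    rcases l with _ | ⟨b, l⟩
    · simp only [List.getLast?_singleton, Option.some.injEq, Sum.inl.injEq] at hlast
      exact absurd (hlast ▸ hα) hy
    · rwa [List.getLast?_cons_cons] at hlast
  have hK : ∀ w, Sum.inl w ∈ l → w ∈ Finset.univ \ S := by
    intro w hw
    refine Finset.mem_sdiff.2 ⟨Finset.mem_univ _, fun hwS => ?_⟩
    obtain ⟨l₁, l₂, rfl⟩ := List.append_of_mem hw
    refine Nat.find_min hex (m := l₂.length) ?_ ⟨w, hwS, l₂, ⟨?_, ?_⟩, ?_, rfl⟩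
    · rw [← hlen]; simp; omega
    · have := hl.1
      rw [← List.cons_append, List.isChain_append] at this
      exact this.2.1
    · have := hl.2
      rw [← List.cons_append] at this
      exact this.of_append_right
    · rw [List.getLast?_append_of_ne_nil _ (by simp)] at hlast'
      exact hlast'
  have htail : IsTail H α (Finset.univ \ S) l := ⟨hl, hK⟩
  refine ⟨α, hα, l, ⟨hl.incGraph_of_forall_mem fun e he => ?_, hK⟩, hlast'⟩
  have he' : Sum.inr e ∈ l := by simpa using he
  obtain ⟨w, hw, hwe⟩ := htail.exists_mem_edge hlast' he'
  exact Finset.mem_filter.2 ⟨htail.edge_mem he', fun hsub =>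
    (Finset.mem_sdiff.1 hw).2 (hsub hwe)⟩

theorem IsNodePath.append_reverse {H : Finset (Finset V)} {v : V} {l₁ l₂ : List (V ⊕ Finset V)}
    (h₁ : IsNodePath (incGraph H) (Sum.inl v :: l₁))
    (h₂ : IsNodePath (incGraph H) (Sum.inl v :: l₂)) (hd : l₁.Disjoint l₂) :
    IsNodePath (incGraph H) (l₁.reverse ++ Sum.inl v :: l₂) := by
  refine ⟨?_, ?_⟩
  · have h := h₁.reverse.1
    rw [List.reverse_cons, List.isChain_append] at h
    rw [List.isChain_append]
    refine ⟨h.1, h₂.1, fun x hx y hy => h.2.2 x hx y ?_⟩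
    simpa using hy
  · have hn₁ := List.nodup_cons.1 h₁.2
    have hn₂ := h₂.2
    rw [List.nodup_append]
    refine ⟨List.nodup_reverse.2 hn₁.2, hn₂, ?_⟩
    rintro x hx y hy rfl
    rw [List.mem_reverse] at hx
    rcases List.mem_cons.1 hy with rfl | hy
    · exact hn₁.1 hx
    · exact hd hx hy

/-- In a connected hypergraph without long paths the copies must be attached somewhere. -/
theorem nonempty_of_copies [Fintype V] {H : Finset (Finset V)} {A : Finset V}
    {C₁ C₂ : Finset (V ⊕ Finset V)} {r k a : ℕ} (hr : 3 ≤ r)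
    (ha : 2 * r ≤ a + 1) (hk : k ≤ 2 * a + 2) (hunif : ∀ e ∈ H, e.card = r)
    (hconn : HConnected H) (hH : IsEmpty (BergePath H k))
    (hC₁ : IsCopy H (a.choose (r - 1)) A C₁) (hC₂ : IsCopy H (a.choose (r - 1)) A C₂)
    (hdisj : ∀ x ∈ C₁, x ∉ C₂) : A.Nonempty := by
  by_contra hA
  rw [Finset.not_nonempty_iff_eq_empty] at hA
  subst hA
  have hsub : ∀ C, IsCopy H (a.choose (r - 1)) ∅ C → ∀ e ∈ C.toRight, e ⊆ C.toLeft := by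
    intro C hC e he
    by_contra h
    obtain ⟨γ, hγ, -⟩ := hC.weak e he (by simpa using h)
    simp at hγ
  have hpos : 0 < a.choose (r - 1) := Nat.choose_pos (by omega)
  have hdense₁ := hC₁.dense
  have hdense₂ := hC₂.dense
  obtain ⟨T₁, hT₁K, ⟨y₁, hy₁⟩, -, hT₁deg⟩ := exists_core (E := C₁.toRight) (K := C₁.toLeft)
    (X := ∅) (D := a.choose (r - 1)) (c := 0) (fun e he => hunif e (hC₁.mem e he)) hC₁.nonempty
    (by
      have hmeet : edgesMeeting C₁.toRight ∅ C₁.toLeft = C₁.toRight := by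
        refine Finset.filter_true_of_mem fun e he => ⟨?_, hC₁.meets e he⟩
        simpa using hsub C₁ hC₁ e he
      rw [hmeet, add_zero]
      exact_mod_cast hdense₁)
    (by simp [Nat.choose_eq_zero_of_lt (by omega : 0 < r - 1)]; omega)
  have hT₁C₂ : ∀ y ∈ T₁, y ∉ C₂.toLeft := fun y hy h =>
    hdisj _ (Finset.mem_toLeft.1 (hT₁K hy)) (Finset.mem_toLeft.1 h)
  obtain ⟨v, hv, l₀, hl₀, hl₀last⟩ := hconn.exists_tail hC₂.nonempty (hT₁C₂ y₁ hy₁)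
  obtain ⟨l₁, hl₁, ⟨z₁, -, hz₁⟩, hlen₁⟩ := exists_long_tail (X := ∅) hr ha
    (E := H.filter fun e => ¬ e ⊆ C₂.toLeft) (fun e he => hunif e (Finset.mem_filter.1 he).1)
    (T := T₁) (α := v) (by simpa using hv) (by simp)
    (fun y hy => Finset.mem_sdiff.2 ⟨Finset.mem_univ _, hT₁C₂ y hy⟩)
    (fun y hy => (hT₁deg y hy).trans_le (Finset.card_le_card fun e he => by
      obtain ⟨he, hye, hesub⟩ := Finset.mem_filter.1 he
      exact Finset.mem_filter.2 ⟨Finset.mem_filter.2 ⟨hC₁.mem e he, fun h =>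
        hT₁C₂ y hy (h hye)⟩, hye, hesub⟩))
    ⟨l₀, hl₀, y₁, hy₁, hl₀last⟩
  have hmeet₂ : edgesMeeting C₂.toRight {v} (C₂.toLeft.erase v) = C₂.toRight := by
    refine Finset.filter_true_of_mem fun e he => ⟨fun w hw => ?_, ?_⟩
    · have := hsub C₂ hC₂ e he hw
      by_cases hwv : w = v <;> simp [hwv, this]
    · obtain ⟨w, hw, hwv⟩ := Finset.exists_mem_ne
        (by rw [hunif e (hC₂.mem e he)]; omega : 1 < e.card) v
      exact ⟨w, Finset.mem_erase.2 ⟨hwv, hsub C₂ hC₂ e he hw⟩, hw⟩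
  obtain ⟨T₂, hT₂K, ⟨y₂, hy₂⟩, -, hT₂deg⟩ := exists_core (E := C₂.toRight)
    (K := C₂.toLeft.erase v) (X := {v}) (D := a.choose (r - 1)) (c := 0)
    (fun e he => hunif e (hC₂.mem e he))
    (by
      have : 0 < C₂.toRight.card :=
        (Nat.mul_pos hpos (Finset.card_pos.2 ⟨v, hv⟩)).trans_le hdense₂
      obtain ⟨e, he⟩ := Finset.card_pos.1 this
      rw [← hmeet₂] at he
      obtain ⟨-, -, w, hw, -⟩ := Finset.mem_filter.1 he
      exact ⟨w, hw⟩)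
    (by
      rw [hmeet₂, add_zero]
      have := (Nat.mul_le_mul_left (a.choose (r - 1))
        (Finset.card_le_card (Finset.erase_subset v C₂.toLeft))).trans hdense₂
      exact_mod_cast this)
    (by simp [Nat.choose_eq_zero_of_lt (by omega : 1 < r - 1)]; omega)
  obtain ⟨l₂, hl₂, -, hlen₂⟩ := exists_long_tail (X := {v}) (α := v) hr ha
    (fun e he => hunif e (hC₂.mem e he)) (by simp) (by simp; omega) hT₂K hT₂deg (by
      obtain ⟨hy₂v, hy₂C⟩ := Finset.mem_erase.1 (hT₂K hy₂)
      obtain ⟨l, hl, hhd, hlast, hlC⟩ := hC₂.conn _ (Finset.mem_toLeft.1 hv) _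
        (Finset.mem_toLeft.1 hy₂C)
      rcases l with _ | ⟨b, l⟩
      · simp at hhd
      obtain rfl : b = Sum.inl v := by simpa using hhd
      refine ⟨l, ⟨hl.incGraph_of_forall_mem fun e he => Finset.mem_toRight.2 (hlC _ he),
        fun w hw => Finset.mem_erase.2 ⟨?_, ?_⟩⟩, y₂, hy₂, ?_⟩
      · rintro rfl
        exact (List.nodup_cons.1 hl.2).1 hw
      · exact Finset.mem_toLeft.2 (hlC _ (List.mem_cons_of_mem _ hw))
      · rcases l with _ | ⟨b, l⟩
        · simp only [List.getLast?_singleton, Option.some.injEq, Sum.inl.injEq] at hlast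
          exact absurd hlast.symm hy₂v
        · rwa [List.getLast?_cons_cons] at hlast)
  have hjoin : IsNodePath (incGraph H) (l₁.reverse ++ Sum.inl v :: l₂) := by
    refine (hl₁.1.mono (incGraph_mono (Finset.filter_subset _ _))).append_reverse
      (hl₂.1.mono (incGraph_mono hC₂.mem)) ?_
    rintro (w | e) h₁ h₂
    · exact (Finset.mem_sdiff.1 (hl₁.2 w h₁)).2 (Finset.mem_erase.1 (hl₂.2 w h₂)).2
    · exact (Finset.mem_filter.1 (hl₁.edge_mem h₁)).2 (hsub C₂ hC₂ e (hl₂.edge_mem h₂))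
  have hlen := hjoin.length_le hH
  simp only [Finset.card_empty, Finset.card_singleton, List.length_append, List.length_reverse,
    List.length_cons] at hlen hlen₁ hlen₂
  omega

end Connected

section Final

variable {V : Type*} {H : Finset (Finset V)} {A T : Finset V} {a r : ℕ}

theorem Finset.exists_mem_ne_ne {α : Type*} {s : Finset α} (hs : 3 ≤ s.card) (x y : α) :
    ∃ z ∈ s, z ≠ x ∧ z ≠ y := by
  obtain ⟨z, hz, hz'⟩ := Finset.exists_mem_notMem_of_card_lt_card
    ((Finset.card_le_two (a := x) (b := y)).trans_lt hs)
  exact ⟨z, hz, by simpa using hz'⟩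

/-- If no path leaving `A` visits three outer vertices, every vertex of a dense core has many
hyperedges meeting `A`. -/
theorem card_edges_meeting_ge [Fintype V] (hr : 3 ≤ r) {D : ℕ} (hD : 3 ≤ D)
    (hunif : ∀ e ∈ H, e.card = r) (hconn : HConnected H) (hA : A.Nonempty) (hTA : Disjoint T A)
    (hpath : ∀ α ∈ A, ∀ y₁ y₂ y₃, y₁ ∉ A → y₂ ∉ A → y₃ ∉ A → y₁ ≠ y₂ → y₁ ≠ y₃ → y₂ ≠ y₃ →
      ∀ e₁ ∈ H, ∀ e₂ ∈ H, ∀ e₃ ∈ H, e₁ ≠ e₂ → e₁ ≠ e₃ → e₂ ≠ e₃ → α ∈ e₁ → y₁ ∈ e₁ →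
      y₁ ∈ e₂ → y₂ ∈ e₂ → y₂ ∈ e₃ → y₃ ∈ e₃ → False)
    (hdeg : ∀ v ∈ T, D < (H.filter fun e => v ∈ e ∧ e ⊆ T ∪ A).card) {y : V} (hy : y ∈ T) :
    D ≤ (H.filter fun e => y ∈ e ∧ e ⊆ T ∪ A ∧ ∃ α ∈ A, α ∈ e).card := by
  have hTA' : ∀ {w}, w ∈ T → w ∉ A := fun h => Finset.disjoint_left.1 hTA h
  suffices hone : (H.filter fun e => y ∈ e ∧ e ⊆ T).card ≤ 1 by
    have hsub : (H.filter fun e => y ∈ e ∧ e ⊆ T ∪ A) ⊆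
        (H.filter fun e => y ∈ e ∧ e ⊆ T ∪ A ∧ ∃ α ∈ A, α ∈ e) ∪
          H.filter fun e => y ∈ e ∧ e ⊆ T := by
      intro e he
      obtain ⟨heH, hye, hesub⟩ := Finset.mem_filter.1 he
      by_cases hex : ∃ α ∈ A, α ∈ e
      · exact Finset.mem_union_left _ (Finset.mem_filter.2 ⟨heH, hye, hesub, hex⟩)
      · refine Finset.mem_union_right _ (Finset.mem_filter.2 ⟨heH, hye, fun w hw => ?_⟩)
        exact (Finset.mem_union.1 (hesub hw)).resolve_right fun h => hex ⟨w, h, hw⟩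
    have := (Finset.card_le_card hsub).trans (Finset.card_union_le _ _)
    have := hdeg y hy
    omega
  by_contra! hlt
  obtain ⟨g, hg, g', hg', hne⟩ := Finset.one_lt_card.1 hlt
  obtain ⟨hgH, hyg, hgT⟩ := Finset.mem_filter.1 hg
  obtain ⟨hgH', hyg', hgT'⟩ := Finset.mem_filter.1 hg'
  obtain ⟨α, hα, l, hl, hlast⟩ := hconn.exists_tail hA (hTA' hy)
  replace hl : IsTail H α (Finset.univ \ A) l :=
    ⟨hl.1.mono (incGraph_mono (Finset.filter_subset _ _)), hl.2⟩
  have hlA : ∀ w, Sum.inl w ∈ l → w ∉ A := fun w hw => (Finset.mem_sdiff.1 (hl.2 w hw)).2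
  have hch := hl.1.1
  have hnd := hl.1.2
  rcases l with _ | ⟨b₁, _ | ⟨b₂, _ | ⟨b₃, _ | ⟨b₄, _ | ⟨b₅, l⟩⟩⟩⟩⟩
  · simp at hlast
  · rcases b₁ with v | f <;> simp at hlast hch
  · rcases b₁ with v | f₁ <;> rcases b₂ with z | f₂ <;> simp at hch hlast
    subst hlast
    obtain ⟨⟨hf₁, hαf₁⟩, -, hzf₁⟩ := hch
    have hf₁g : f₁ ≠ g := by rintro rfl; exact hTA' (hgT hαf₁) hα
    obtain ⟨w, hwg, hwz⟩ := Finset.exists_mem_ne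
      (by rw [hunif g hgH]; omega : 1 < g.card) z
    obtain ⟨h, hh, hnot⟩ := Finset.exists_mem_notMem_of_card_lt_card
      ((Finset.card_le_three (a := f₁) (b := g) (c := g')).trans_lt
        (hD.trans_lt (hdeg w (hgT hwg))))
    simp only [Finset.mem_insert, Finset.mem_singleton, not_or] at hnot
    obtain ⟨hhH, hwh, hhT⟩ := Finset.mem_filter.1 hh
    obtain ⟨x, hxh, hxz, hxw⟩ := Finset.exists_mem_ne_ne (by rw [hunif h hhH]; omega) z w
    by_cases hxA : x ∈ A
    · obtain ⟨u, hug', huz, huw⟩ := Finset.exists_mem_ne_ne (by rw [hunif g' hgH']; omega) z w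
      exact hpath x hxA w z u (hTA' (hgT hwg)) (hTA' hy) (hTA' (hgT' hug')) hwz huw.symm
        huz.symm h hhH g hgH g' hgH' hnot.2.1 hnot.2.2 hne hxh hwh hwg hyg hyg' hug'
    · exact hpath α hα z w x (hTA' hy) (hTA' (hgT hwg)) hxA hwz.symm hxz.symm hxw.symm
        f₁ hf₁ g hgH h hhH hf₁g (Ne.symm hnot.1) (Ne.symm hnot.2.1) hαf₁ hzf₁ hyg hwg hwh hxh
  · rcases b₁ with v | f₁ <;> rcases b₂ with z | f₂ <;> rcases b₃ with z | f₃ <;>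
      simp at hch hlast
  · rcases b₁ with v | f₁ <;> rcases b₂ with z | f₂ <;> rcases b₃ with w | f₃ <;>
      rcases b₄ with x | f₄ <;> simp at hch hlast
    subst hlast
    obtain ⟨⟨hf₁, hαf₁⟩, ⟨-, hzf₁⟩, ⟨hf₃, hzf₃⟩, -, hxf₃⟩ := hch
    have hzx : z ≠ x := by
      rintro rfl
      simp at hnd
    have hf₁₃ : f₁ ≠ f₃ := by
      rintro rfl
      simp at hnd
    have hend : ∀ h ∈ H, x ∈ h → h ⊆ T → h ≠ f₃ → False := by
      intro h hhH hxh hhT hhf₃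
      obtain ⟨u, huh, huz, hux⟩ := Finset.exists_mem_ne_ne (by rw [hunif h hhH]; omega) z x
      exact hpath α hα z x u (hlA z (by simp)) (hTA' hy) (hTA' (hhT huh)) hzx huz.symm hux.symm
        f₁ hf₁ f₃ hf₃ h hhH hf₁₃ (by rintro rfl; exact hTA' (hhT hαf₁) hα) hhf₃.symm hαf₁ hzf₁
        hzf₃ hxf₃ hxh huh
    by_cases hgf : g = f₃
    · exact hend g' hgH' hyg' hgT' fun h => hne (hgf.trans h.symm)
    · exact hend g hgH hyg hgT hgf
  · rcases b₁ with v | f₁ <;> rcases b₂ with z | f₂ <;> rcases b₃ with w | f₃ <;>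
      rcases b₄ with x | f₄ <;> rcases b₅ with u | f₅ <;> simp at hch hlast
    rcases l with _ | ⟨b₆, l⟩
    · simp at hlast
    rcases b₆ with u | f₆ <;> simp at hch
    simp only [List.nodup_cons, List.mem_cons, not_or] at hnd
    obtain ⟨⟨hf₁, hαf₁⟩, ⟨-, hzf₁⟩, ⟨hf₃, hzf₃⟩, ⟨-, hxf₃⟩, ⟨hf₅, hxf₅⟩, ⟨-, huf₅⟩, -⟩ := hch
    refine hpath α hα z x u (hlA z (by simp)) (hlA x (by simp)) (hlA u (by simp)) ?_ ?_ ?_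
      f₁ hf₁ f₃ hf₃ f₅ hf₅ ?_ ?_ ?_ hαf₁ hzf₁ hzf₃ hxf₃ hxf₅ huf₅ <;> rintro rfl <;> simp at hnd

/-- The hyperedges meeting a core in at least two vertices all have the same trace. -/
theorem card_edgesMeeting_le (hr : 3 ≤ r) (hra : r ≤ a + 2) (hunif : ∀ e ∈ H, e.card = r)
    (hA : A.card = a) (hTA : Disjoint T A)
    (hpath : ∀ α ∈ A, ∀ y₁ y₂ y₃, y₁ ∉ A → y₂ ∉ A → y₃ ∉ A → y₁ ≠ y₂ → y₁ ≠ y₃ → y₂ ≠ y₃ →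
      ∀ e₁ ∈ H, ∀ e₂ ∈ H, ∀ e₃ ∈ H, e₁ ≠ e₂ → e₁ ≠ e₃ → e₂ ≠ e₃ → α ∈ e₁ → y₁ ∈ e₁ →
      y₁ ∈ e₂ → y₂ ∈ e₂ → y₂ ∈ e₃ → y₃ ∈ e₃ → False)
    (hpair : ∀ α ∈ A, ∀ α' ∈ A, α ≠ α' → ∀ y₁ y₂ y₃ y₄, y₁ ∉ A → y₂ ∉ A → y₃ ∉ A → y₄ ∉ A →
      [y₁, y₂, y₃, y₄].Nodup → ∀ e₁ ∈ H, ∀ e₂ ∈ H, ∀ e₃ ∈ H, ∀ e₄ ∈ H,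
      [e₁, e₂, e₃, e₄].Nodup → α ∈ e₁ → y₁ ∈ e₁ → y₁ ∈ e₂ → y₂ ∈ e₂ → α' ∈ e₃ → y₃ ∈ e₃ →
      y₃ ∈ e₄ → y₄ ∈ e₄ → False)
    (hdeg : ∀ y ∈ T, 5 ≤ (H.filter fun e => y ∈ e ∧ e ⊆ T ∪ A ∧ ∃ α ∈ A, α ∈ e).card) :
    (edgesMeeting H A T).card ≤ a.choose (r - 1) * T.card + a.choose (r - 2) := by
  have hTA' : ∀ {w}, w ∈ T → w ∉ A := fun h => Finset.disjoint_left.1 hTA h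
  have hsplit : ∀ e, e ⊆ T ∪ A → (e ∩ T) ∪ (e ∩ A) = e := by
    intro e he
    rw [← Finset.inter_union_distrib_left, Finset.inter_eq_left.2 he]
  have hcardsplit : ∀ e ∈ H, e ⊆ T ∪ A → (e ∩ T).card + (e ∩ A).card = r := by
    intro e he hsub
    rw [← Finset.card_union_of_disjoint
      (hTA.mono Finset.inter_subset_right Finset.inter_subset_right), hsplit e hsub, hunif e he]
  set F := H.filter fun e => e ⊆ T ∪ A ∧ 1 < (e ∩ T).card with hF
  have hshare : ∀ e ∈ F, ∀ e' ∈ F, e ≠ e' → ∀ y₂, y₂ ∈ e → y₂ ∈ e' → y₂ ∈ T →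
      e ∩ T = e' ∩ T ∧ (e ∩ T).card = 2 := by
    intro e he e' he' hne y₂ hye hye' hyT
    obtain ⟨heH, heT, hecard⟩ := Finset.mem_filter.1 he
    obtain ⟨heH', heT', hecard'⟩ := Finset.mem_filter.1 he'
    have huniq : ∀ y₁ ∈ e ∩ T, ∀ y₃ ∈ e' ∩ T, y₁ ≠ y₂ → y₃ ≠ y₂ → y₁ = y₃ := by
      intro y₁ hy₁ y₃ hy₃ h₁₂ h₃₂
      by_contra h₁₃
      rw [Finset.mem_inter] at hy₁ hy₃
      obtain ⟨g, hg, hnot⟩ := Finset.exists_mem_notMem_of_card_lt_card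
        ((Finset.card_le_two (a := e) (b := e')).trans_lt
          ((by norm_num : 2 < 5).trans_le (hdeg y₃ hy₃.2)))
      simp only [Finset.mem_insert, Finset.mem_singleton, not_or] at hnot
      obtain ⟨hgH, hyg, -, α, hα, hαg⟩ := Finset.mem_filter.1 hg
      exact hpath α hα y₃ y₂ y₁ (hTA' hy₃.2) (hTA' hyT) (hTA' hy₁.2) h₃₂ (Ne.symm h₁₃) h₁₂.symm
        g hgH e' heH' e heH hnot.2 hnot.1 hne.symm hαg hyg hy₃.1 hye' hye hy₁.1
    obtain ⟨y₁, hy₁, h₁₂⟩ := Finset.exists_mem_ne hecard y₂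
    obtain ⟨y₃, hy₃, h₃₂⟩ := Finset.exists_mem_ne hecard' y₂
    have he₁ : e ∩ T = {y₂, y₁} := by
      ext w
      rw [Finset.mem_insert, Finset.mem_singleton]
      refine ⟨fun hw => ?_, ?_⟩
      · by_cases hw₂ : w = y₂
        · exact Or.inl hw₂
        · exact Or.inr ((huniq w hw y₃ hy₃ hw₂ h₃₂).trans (huniq y₁ hy₁ y₃ hy₃ h₁₂ h₃₂).symm)
      · rintro (rfl | rfl)
        · exact Finset.mem_inter.2 ⟨hye, hyT⟩
        · exact hy₁
    have he₂ : e' ∩ T = {y₂, y₁} := by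
      ext w
      rw [Finset.mem_insert, Finset.mem_singleton]
      refine ⟨fun hw => ?_, ?_⟩
      · by_cases hw₂ : w = y₂
        · exact Or.inl hw₂
        · exact Or.inr (huniq y₁ hy₁ w hw h₁₂ hw₂).symm
      · rintro (rfl | rfl)
        · exact Finset.mem_inter.2 ⟨hye', hyT⟩
        · exact huniq w hy₁ y₃ hy₃ h₁₂ h₃₂ ▸ hy₃
    exact ⟨he₁.trans he₂.symm, by rw [he₁, Finset.card_pair h₁₂.symm]⟩
  have hmeet : ∀ e ∈ F, ∀ e' ∈ F, e ≠ e' → ∃ y, y ∈ e ∧ y ∈ e' ∧ y ∈ T := by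
    intro e he e' he' hne
    by_contra! hno
    obtain ⟨heH, heT, hecard⟩ := Finset.mem_filter.1 he
    obtain ⟨heH', heT', hecard'⟩ := Finset.mem_filter.1 he'
    obtain ⟨y₁, hy₁, y₂, hy₂, h₁₂⟩ := Finset.one_lt_card.1 hecard
    obtain ⟨y₃, hy₃, y₄, hy₄, h₃₄⟩ := Finset.one_lt_card.1 hecard'
    rw [Finset.mem_inter] at hy₁ hy₂ hy₃ hy₄
    obtain ⟨g, hg, hnot⟩ := Finset.exists_mem_notMem_of_card_lt_card
      ((Finset.card_le_two (a := e) (b := e')).trans_lt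
        ((by norm_num : 2 < 5).trans_le (hdeg y₁ hy₁.2)))
    simp only [Finset.mem_insert, Finset.mem_singleton, not_or] at hnot
    obtain ⟨hgH, hyg, -, α, hα, hαg⟩ := Finset.mem_filter.1 hg
    have hkey : ∀ g' ∈ H.filter (fun e => y₃ ∈ e ∧ e ⊆ T ∪ A ∧ ∃ α ∈ A, α ∈ e),
        g' ∉ ({e, e', g} : Finset (Finset V)) → g' = (e' ∩ T) ∪ {α} := by
      intro g' hg' hnot'
      simp only [Finset.mem_insert, Finset.mem_singleton, not_or] at hnot'
      obtain ⟨hgH', hyg', hgT', α', hα', hαg'⟩ := Finset.mem_filter.1 hg'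
      have hall : ∀ β ∈ A, β ∈ g' → β = α := by
        intro β hβ hβg'
        by_contra hβα
        refine hpair α hα β hβ (Ne.symm hβα) y₁ y₂ y₃ y₄ (hTA' hy₁.2) (hTA' hy₂.2)
          (hTA' hy₃.2) (hTA' hy₄.2) ?_ g hgH e heH g' hgH' e' heH' ?_ hαg hyg hy₁.1 hy₂.1 hβg'
          hyg' hy₃.1 hy₄.1
        · have h₁₃ : y₁ ≠ y₃ := by rintro rfl; exact hno _ hy₁.1 hy₃.1 hy₁.2
          have h₁₄ : y₁ ≠ y₄ := by rintro rfl; exact hno _ hy₁.1 hy₄.1 hy₁.2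
          have h₂₃ : y₂ ≠ y₃ := by rintro rfl; exact hno _ hy₂.1 hy₃.1 hy₂.2
          have h₂₄ : y₂ ≠ y₄ := by rintro rfl; exact hno _ hy₂.1 hy₄.1 hy₂.2
          simp [h₁₂, h₁₃, h₁₄, h₂₃, h₂₄, h₃₄]
        · simp [hnot.1, hnot.2, Ne.symm hnot'.2.2, Ne.symm hnot'.1, hne, hnot'.2.1]
      have hgA : g' ∩ A = {α} := by
        refine Finset.eq_singleton_iff_unique_mem.2 ⟨?_, fun β hβ => ?_⟩
        · rw [← hall α' hα' hαg']
          exact Finset.mem_inter.2 ⟨hαg', hα'⟩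
        · exact hall β (Finset.mem_inter.1 hβ).2 (Finset.mem_inter.1 hβ).1
      have hgF : g' ∈ F := by
        have := hcardsplit g' hgH' hgT'
        rw [hgA, Finset.card_singleton] at this
        exact Finset.mem_filter.2 ⟨hgH', hgT', by omega⟩
      rw [← hsplit g' hgT', hgA, (hshare g' hgF e' he' hnot'.2.1 y₃ hyg' hy₃.1 hy₃.2).1]
    have hle : (H.filter fun e => y₃ ∈ e ∧ e ⊆ T ∪ A ∧ ∃ α ∈ A, α ∈ e).card ≤
        ({e, e', g, (e' ∩ T) ∪ {α}} : Finset (Finset V)).card := by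
      refine Finset.card_le_card fun g' hg' => ?_
      by_cases h : g' ∈ ({e, e', g} : Finset (Finset V))
      · simp only [Finset.mem_insert, Finset.mem_singleton] at h ⊢
        tauto
      · simp [hkey g' hg' h]
    have := hle.trans Finset.card_le_four
    have := hdeg y₃ hy₃.2
    omega
  have hFcard : F.card ≤ a.choose (r - 2) := by
    rcases Nat.lt_or_ge 1 F.card with hlt | hle
    · obtain ⟨e₀, he₀, e₁, he₁, hne⟩ := Finset.one_lt_card.1 hlt
      have htrace : ∀ e ∈ F, e ∩ T = e₀ ∩ T ∧ (e ∩ T).card = 2 := by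
        intro e he
        by_cases h : e = e₀
        · subst h
          obtain ⟨y, hy, hy', hyT⟩ := hmeet e he e₁ he₁ hne
          exact ⟨rfl, (hshare e he e₁ he₁ hne y hy hy' hyT).2⟩
        · obtain ⟨y, hy, hy', hyT⟩ := hmeet e he e₀ he₀ h
          exact hshare e he e₀ he₀ h y hy hy' hyT
      rw [← hA, ← Finset.card_powersetCard]
      refine Finset.card_le_card_of_injOn (fun e => e ∩ A) (fun e he => ?_) ?_
      · have he' := Finset.mem_filter.1 he
        have := hcardsplit e he'.1 he'.2.1
        have := (htrace e he).2
        rw [Finset.mem_coe, Finset.mem_powersetCard]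
        exact ⟨Finset.inter_subset_right, by dsimp only; omega⟩
      · intro e he e' he' heq
        have h₁ := hsplit e (Finset.mem_filter.1 he).2.1
        have h₂ := hsplit e' (Finset.mem_filter.1 he').2.1
        dsimp only at heq
        rw [← h₁, ← h₂, heq, (htrace e he).1, (htrace e' he').1]
    · exact hle.trans (Nat.choose_pos (by omega))
  have hcover : edgesMeeting H A T ⊆
      (T.biUnion fun v => H.filter fun e => v ∈ e ∧ e ⊆ insert v A) ∪ F := by
    intro e he
    obtain ⟨heH, hesub, v, hvT, hve⟩ := Finset.mem_filter.1 he
    by_cases h : 1 < (e ∩ T).card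
    · exact Finset.mem_union_right _ (Finset.mem_filter.2 ⟨heH, hesub, h⟩)
    · refine Finset.mem_union_left _ (Finset.mem_biUnion.2 ⟨v, hvT,
        Finset.mem_filter.2 ⟨heH, hve, fun w hw => ?_⟩⟩)
      rw [Finset.mem_insert]
      refine (Finset.mem_union.1 (hesub hw)).imp_left fun hwT => ?_
      exact Finset.card_le_one.1 (not_lt.1 h) w (Finset.mem_inter.2 ⟨hw, hwT⟩) v
        (Finset.mem_inter.2 ⟨hve, hvT⟩)
  have hbi : (T.biUnion fun v => H.filter fun e => v ∈ e ∧ e ⊆ insert v A).card ≤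
      T.card * a.choose (r - 1) := by
    refine Finset.card_biUnion_le_card_mul _ _ _ fun v hv => ?_
    refine card_le_choose_of_mem_of_subset (B := insert v A) (y := v) (fun e he => ?_) ?_
    · obtain ⟨heH, hve, hsub⟩ := Finset.mem_filter.1 he
      exact ⟨hunif e heH, hve, hsub⟩
    · rw [Finset.erase_insert (hTA' hv), hA]
  calc (edgesMeeting H A T).card ≤ _ := Finset.card_le_card hcover
    _ ≤ _ := Finset.card_union_le _ _
    _ ≤ T.card * a.choose (r - 1) + a.choose (r - 2) := Nat.add_le_add hbi hFcard
    _ = _ := by rw [mul_comm]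

end Final

section Main

variable {V : Type*} {H : Finset (Finset V)} {A : Finset V} {a r k : ℕ}

/-- A path leaving `A` can be prolonged through all of `A` by using the copies. -/
theorem length_le_of_copies {D : ℕ} (hH : IsEmpty (BergePath H k))
    {F : Finset (Finset (V ⊕ Finset V))} (hF : A.card + 4 * k + 2 ≤ F.card)
    (hcopy : ∀ C ∈ F, IsCopy H D A C)
    (hdisj : ∀ C ∈ F, ∀ C' ∈ F, ∀ x ∈ C, x ∈ C' → C = C') (hA : 1 < A.card) {α y : V}
    (hα : α ∈ A) {l : List (V ⊕ Finset V)} (hl : IsNodePath (incGraph H) (Sum.inl α :: l))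
    (hlA : ∀ β ∈ A, Sum.inl β ∉ l) (hlast : l.getLast? = some (Sum.inl y)) :
    l.length + 4 * A.card ≤ 2 * k + 1 := by
  obtain ⟨C, hC, hCl⟩ : ∃ C ∈ F, ∀ x ∈ l, x ∉ C := by
    by_contra! hno
    have : Nonempty (V ⊕ Finset V) := ⟨Sum.inl α⟩
    choose! f hf hfC using hno
    have h₁ : F.card ≤ l.toFinset.card := by
      refine Finset.card_le_card_of_injOn f (fun C hC => by simpa using hf C hC) ?_
      intro C hC C' hC' heq
      exact hdisj C hC C' hC' _ (hfC C hC) (heq ▸ hfC C' hC')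
    have h₂ := l.toFinset_card_le
    have h₃ := hl.length_le_of_inl hH
    omega
  obtain ⟨β, hβ, hβα⟩ := Finset.exists_mem_ne hA α
  obtain ⟨l', hl', hl'C, -, hlen⟩ := (hcopy C hC).exists_short_tail hβ
  have := length_add_length_le_of_links hH (fun C hC => (hcopy C hC).links) hdisj hF hα hβ
    (fun h => absurd h.symm hβα) hl hl' hlA
    (fun γ hγ h => (hcopy C hC).notMem γ hγ (hl'C _ h))
    (fun x hx hx' => hCl x hx (hl'C x hx')) hlast
  omega

theorem card_le_of_copies [Fintype V] (hr : 3 ≤ r) (ha : 2 * r ≤ a + 1)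
    (hk : k = 2 * a + 1 ∨ k = 2 * a + 2) (hunif : ∀ e ∈ H, e.card = r) (hconn : HConnected H)
    (hH : IsEmpty (BergePath H k)) {F : Finset (Finset (V ⊕ Finset V))}
    (hF : A.card + 4 * k + 2 ≤ F.card) (hcopy : ∀ C ∈ F, IsCopy H (a.choose (r - 1)) A C)
    (hdisj : ∀ C ∈ F, ∀ C' ∈ F, ∀ x ∈ C, x ∈ C' → C = C') (hA : A.card = a) :
    H.card ≤ a.choose r + a.choose (r - 1) * (Fintype.card V - a) +
      if k = 2 * a + 1 then 0 else a.choose (r - 2) := by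
  by_contra! hlt
  set s := if k = 2 * a + 1 then 0 else a.choose (r - 2) with hs
  have hAne : A.Nonempty := Finset.card_pos.1 (by omega)
  have hD : 5 ≤ a.choose (r - 1) := by
    have := choose_add_lt (x := 0) (w := a - 1) hr ha (by omega)
    omega
  have hmeet : edgesMeeting H A (Finset.univ \ A) = H.filter fun e => ¬ e ⊆ A := by
    refine Finset.filter_congr fun e _ => ?_
    have hsub : e ⊆ Finset.univ \ A ∪ A := fun v _ => by simp
    rw [and_iff_right hsub]
    simp [Finset.not_subset, and_comm]
  have hinner : (H.filter fun e => e ⊆ A).card ≤ a.choose r := by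
    rw [← hA, ← Finset.card_powersetCard]
    refine Finset.card_le_card fun e he => ?_
    obtain ⟨heH, heA⟩ := Finset.mem_filter.1 he
    exact Finset.mem_powersetCard.2 ⟨heA, hunif e heH⟩
  have hsum : (H.filter fun e => e ⊆ A).card + (H.filter fun e => ¬ e ⊆ A).card = H.card :=
    Finset.card_filter_add_card_filter_not _
  have hout : (Finset.univ \ A).card = Fintype.card V - a := by
    rw [Finset.card_univ_sdiff, hA]
  have hne : (Finset.univ \ A).Nonempty := by
    obtain ⟨C, hC⟩ : F.Nonempty := Finset.card_pos.1 (by omega)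
    obtain ⟨v, hv⟩ := (hcopy C hC).nonempty
    exact ⟨v, Finset.mem_sdiff.2 ⟨Finset.mem_univ _, fun h =>
      (hcopy C hC).notMem v h (Finset.mem_toLeft.1 hv)⟩⟩
  obtain ⟨T, hTK, ⟨y, hy⟩, hTcard, hTdeg⟩ := exists_core (E := H) (K := Finset.univ \ A) (X := A)
    (D := a.choose (r - 1)) (c := (s + 1 : ℕ)) hunif hne
    (by
      rw [hmeet, hout]
      have : a.choose (r - 1) * (Fintype.card V - a) + (s + 1) ≤
        (H.filter fun e => ¬ e ⊆ A).card := by omega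
      exact_mod_cast this)
    (by rw [hA]; push_cast; omega)
  have hTA : Disjoint T A := Finset.disjoint_left.2 fun v hv => (Finset.mem_sdiff.1 (hTK hv)).2
  rcases hk with hk | hk
  · obtain ⟨α, hα, l₀, hl₀, hlast₀⟩ := hconn.exists_tail hAne (Finset.disjoint_left.1 hTA hy)
    obtain ⟨l, hl, ⟨z, -, hz⟩, hlen⟩ := exists_long_tail (E := H) (α := α) hr ha hunif
      (by simpa using hα) hA.le hTK hTdeg
      ⟨l₀, ⟨hl₀.1.mono (incGraph_mono (Finset.filter_subset _ _)), hl₀.2⟩, y, hy, hlast₀⟩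
    have := length_le_of_copies hH hF hcopy hdisj (by omega) hα hl.1
      (fun β hβ h => (Finset.mem_sdiff.1 (hl.2 β h)).2 hβ) hz
    omega
  · have hpath : ∀ α ∈ A, ∀ y₁ y₂ y₃, y₁ ∉ A → y₂ ∉ A → y₃ ∉ A → y₁ ≠ y₂ → y₁ ≠ y₃ →
        y₂ ≠ y₃ → ∀ e₁ ∈ H, ∀ e₂ ∈ H, ∀ e₃ ∈ H, e₁ ≠ e₂ → e₁ ≠ e₃ → e₂ ≠ e₃ → α ∈ e₁ →
        y₁ ∈ e₁ → y₁ ∈ e₂ → y₂ ∈ e₂ → y₂ ∈ e₃ → y₃ ∈ e₃ → False := by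
      intro α hα y₁ y₂ y₃ hy₁ hy₂ hy₃ h₁₂ h₁₃ h₂₃ e₁ he₁ e₂ he₂ e₃ he₃ hne₁₂ hne₁₃ hne₂₃
        hαe₁ h₁₁ h₁₂' h₂₂ h₂₃' h₃₃
      have hαne : ∀ y, y ∉ A → α ≠ y := fun y hy h => hy (h ▸ hα)
      have := length_le_of_copies hH hF hcopy hdisj (by omega) hα (y := y₃)
        (l := [Sum.inr e₁, Sum.inl y₁, Sum.inr e₂, Sum.inl y₂, Sum.inr e₃, Sum.inl y₃])
        ⟨by simp [*], by simp [*]⟩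
        (by
          intro β hβ h
          simp only [List.mem_cons, reduceCtorEq, Sum.inl.injEq, List.not_mem_nil, or_false,
            false_or] at h
          rcases h with rfl | rfl | rfl <;> contradiction)
        (by simp)
      simp only [List.length_cons, List.length_nil] at this
      omega
    have hpair : ∀ α ∈ A, ∀ α' ∈ A, α ≠ α' → ∀ y₁ y₂ y₃ y₄, y₁ ∉ A → y₂ ∉ A → y₃ ∉ A →
        y₄ ∉ A → [y₁, y₂, y₃, y₄].Nodup → ∀ e₁ ∈ H, ∀ e₂ ∈ H, ∀ e₃ ∈ H, ∀ e₄ ∈ H,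
        [e₁, e₂, e₃, e₄].Nodup → α ∈ e₁ → y₁ ∈ e₁ → y₁ ∈ e₂ → y₂ ∈ e₂ → α' ∈ e₃ → y₃ ∈ e₃ →
        y₃ ∈ e₄ → y₄ ∈ e₄ → False := by
      intro α hα α' hα' hαα' y₁ y₂ y₃ y₄ hy₁ hy₂ hy₃ hy₄ hy e₁ he₁ e₂ he₂ e₃ he₃ e₄ he₄ he
        hαe₁ h₁₁ h₁₂ h₂₂ hαe₃ h₃₃ h₃₄ h₄₄
      have hαne : ∀ β ∈ A, ∀ y, y ∉ A → β ≠ y := fun β hβ y hy h => hy (h ▸ hβ)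
      simp only [List.nodup_cons, List.mem_cons, List.not_mem_nil, or_false, not_or,
        List.nodup_nil, not_false_eq_true, and_true] at hy he
      obtain ⟨⟨hy₁₂, hy₁₃, hy₁₄⟩, ⟨hy₂₃, hy₂₄⟩, hy₃₄⟩ := hy
      obtain ⟨⟨he₁₂, he₁₃, he₁₄⟩, ⟨he₂₃, he₂₄⟩, he₃₄⟩ := he
      have := length_add_length_le_of_links hH (fun C hC => (hcopy C hC).links) hdisj hF hα hα'
        (fun h => absurd h hαα')
        (T₁ := [Sum.inr e₁, Sum.inl y₁, Sum.inr e₂, Sum.inl y₂])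
        (T₂ := [Sum.inr e₃, Sum.inl y₃, Sum.inr e₄, Sum.inl y₄]) (y := y₂)
        ⟨by simp [*], by simp [hαne α hα, *]⟩ ⟨by simp [*], by simp [hαne α' hα', *]⟩
        (by
          intro β hβ
          simp [hαne β hβ, *])
        (by
          intro β hβ
          simp [hαne β hβ, *])
        (by simp [*, eq_comm (a := e₃), eq_comm (a := e₄), eq_comm (a := y₃), eq_comm (a := y₄)])
        (by simp)
      simp only [List.length_cons, List.length_nil] at this
      omega
    have hle := card_edgesMeeting_le hr (by omega) hunif hA hTA hpath hpair fun y hy =>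
      hD.trans (card_edges_meeting_ge hr (by omega) hunif hconn hAne hTA hpath hTdeg hy)
    have hs' : s = a.choose (r - 2) := if_neg (by omega)
    have : a.choose (r - 1) * T.card + (s + 1) ≤ (edgesMeeting H A T).card := by
      exact_mod_cast hTcard
    omega

end Main

/-- Füredi–Kostochka–Luo. For `k ≥ 4r ≥ 12` there exists `n'_{k,r} ≥ k`
such that for all `n ≥ n'_{k,r}`, every connected `r`-uniform hypergraph on `n` vertices
with no Berge-path of length `k` has at most
`C(k − ⌊(k−1)/2⌋, r) + (n − k + ⌊(k−1)/2⌋)·C(⌊(k−1)/2⌋, r−1)` hyperedges. -/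
theorem furedi_kostochka_luo_connected
    (r k : ℕ) (hk : 4 * r ≤ k) (hr : 12 ≤ 4 * r) :
    ∃ n' : ℕ, k ≤ n' ∧ ∀ n : ℕ, n' ≤ n → ∀ H : Finset (Finset (Fin n)),
      (∀ e ∈ H, e.card = r) → HConnected H → IsEmpty (BergePath H k) →
      H.card ≤ (k - (k - 1) / 2).choose r +
        (n - k + (k - 1) / 2) * ((k - 1) / 2).choose (r - 1) := by
  set a := (k - 1) / 2 with ha
  set R := partBound (partsNeeded r k (6 * k + 3)) (2 * k + 2) with hR
  refine ⟨max k ((R + 1) * (a.choose (r - 1) * a + R + 1)), le_max_left _ _, ?_⟩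
  intro n hn H hunif hconn hH
  have hkn : k ≤ n := (le_max_left _ _).trans hn
  have hparity : k = 2 * a + 1 ∨ k = 2 * a + 2 := by omega
  have hbound : (k - a).choose r + (n - k + a) * a.choose (r - 1) =
      a.choose r + a.choose (r - 1) * (n - a) +
        if k = 2 * a + 1 then 0 else a.choose (r - 2) := by
    obtain ⟨t, rfl⟩ : ∃ t, r = t + 2 := ⟨r - 2, by omega⟩
    rcases hparity with h | h
    · rw [if_pos h, show k - a = a + 1 by omega]
      obtain ⟨m, hm⟩ : ∃ m, n - k + a = m := ⟨_, rfl⟩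
      rw [hm, show n - a = m + 1 by omega]
      simp only [Nat.choose_succ_succ, show t + 2 - 1 = t + 1 by omega]
      ring
    · rw [if_neg (by omega), show k - a = a + 2 by omega]
      obtain ⟨m, hm⟩ : ∃ m, n - k + a = m := ⟨_, rfl⟩
      rw [hm, show n - a = m + 2 by omega]
      simp only [Nat.choose_succ_succ, Nat.add_sub_cancel, show t + 2 - 1 = t + 1 by omega]
      ring
  rw [hbound]
  by_contra! hlt
  have hcard : a.choose (r - 1) * n ≤ H.card + a.choose (r - 1) * a := by
    have : a.choose (r - 1) * n = a.choose (r - 1) * (n - a) + a.choose (r - 1) * a := by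
      rw [← Nat.mul_add, Nat.sub_add_cancel (by omega)]
    omega
  obtain ⟨A, F, hAcard, hF, hcopy, hdisj⟩ := exists_copies (M := 6 * k + 3) hunif (by omega) hH
    (Nat.choose_pos (by omega) : 0 < a.choose (r - 1)) (by simpa using hcard)
    (by simpa using (le_max_right _ _).trans hn)
  obtain ⟨C₁, hC₁, C₂, hC₂, hne⟩ := Finset.one_lt_card.1 (by omega : 1 < F.card)
  have hA : A.Nonempty := nonempty_of_copies (by omega) (by omega) (by omega) hunif hconn hH
    (hcopy C₁ hC₁) (hcopy C₂ hC₂) fun x hx hx' => hne (hdisj C₁ hC₁ C₂ hC₂ x hx hx')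
  have hAa := card_eq_of_copies (by omega) (by omega) (by omega) hunif hH (by omega) hcopy hdisj hA
  have := card_le_of_copies (by omega) (by omega) hparity hunif hconn hH (by omega) hcopy hdisj hAa
  rw [Fintype.card_fin] at this
  omega
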